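/- Let U be a bounded nonconvex domain in ℝ² with Lipschitz boundary ∂U, and suppose there exists a point P ∈ ∂U such that on the set ∂U \ {P} the domain U is locally strictly convex with its convexity directed toward the complement of U. Then U is uniquely determined in the class of all plane domains by the condition of local isometry of boundaries in the relative metrics: for every plane domain V, if there exists a bijective local isometry between the Hausdorff boundaries ∂_H U and ∂_H V in their relative metrics, then there exists a Euclidean isometry J: ℝ² → ℝ² with J(U) = V. -/

import Mathlib

open Set Filter Metric Topology ENNReal

noncomputable section

/-- A domain in `ℝⁿ`: a nonempty open connected set. -/
def IsDomainSet {n : ℕ} (U : Set (EuclideanSpace ℝ (Fin n))) : Prop :=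
  IsOpen U ∧ IsConnected U

/-- The intrinsic distance inside a set `U`: the infimum of lengths of
(continuous) paths joining `a` and `b` inside `U`. -/
def intrinsicDist {n : ℕ} (U : Set (EuclideanSpace ℝ (Fin n)))
    (a b : EuclideanSpace ℝ (Fin n)) : ℝ≥0∞ :=
  ⨅ (γ : ℝ → EuclideanSpace ℝ (Fin n)) (_ : ContinuousOn γ (Icc (0:ℝ) 1))
    (_ : γ 0 = a) (_ : γ 1 = b) (_ : ∀ t ∈ Icc (0:ℝ) 1, γ t ∈ U),
    eVariationOn γ (Icc 0 1)

/-- A sequence which is Cauchy with respect to the intrinsic metric `ρ_U`. -/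
def IntrinsicCauchy {n : ℕ} (U : Set (EuclideanSpace ℝ (Fin n)))
    (x : ℕ → EuclideanSpace ℝ (Fin n)) : Prop :=
  ∀ ε : ℝ≥0∞, 0 < ε → ∃ N, ∀ m ≥ N, ∀ k ≥ N, intrinsicDist U (x m) (x k) < ε

/-- An element of the Hausdorff boundary `∂_H U`, represented by a Cauchy
sequence (in the intrinsic metric of `U`) that does not correspond
to a point of `U`. Two such elements with `hDist a b = 0` represent
the same point of `∂_H U`. -/
structure HPoint {n : ℕ} (U : Set (EuclideanSpace ℝ (Fin n))) where
  seq : ℕ → EuclideanSpace ℝ (Fin n)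
  mem : ∀ k, seq k ∈ U
  cauchy : IntrinsicCauchy U seq
  not_inner : ¬ ∃ u ∈ U, Tendsto (fun k => intrinsicDist U (seq k) u) atTop (𝓝 0)

/-- The relative metric `ρ_{∂_H U, U}` on the Hausdorff boundary. -/
def hDist {n : ℕ} {U : Set (EuclideanSpace ℝ (Fin n))} (a b : HPoint U) : ℝ≥0∞ :=
  Filter.liminf (fun k => intrinsicDist U (a.seq k) (b.seq k)) atTop

/-- `f` represents a bijective mapping `∂_H U → ∂_H V` which is a local
isometry in the relative metrics of the Hausdorff boundaries. -/
def HBoundaryLocalIsometry {n : ℕ} {U V : Set (EuclideanSpace ℝ (Fin n))}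
    (f : HPoint U → HPoint V) : Prop :=
  (∀ a b : HPoint U, hDist a b = 0 ↔ hDist (f a) (f b) = 0) ∧
  (∀ b : HPoint V, ∃ a : HPoint U, hDist (f a) b = 0) ∧
  ∀ w : HPoint U, ∃ ε : ℝ≥0∞, 0 < ε ∧ ∀ a b : HPoint U,
    hDist a w < ε → hDist b w < ε → hDist a b = hDist (f a) (f b)

/-- The support of an element of the Hausdorff boundary: the Euclidean limit
of a representing sequence. -/
def hSupport {n : ℕ} {U : Set (EuclideanSpace ℝ (Fin n))} (a : HPoint U) :
    EuclideanSpace ℝ (Fin n) :=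
  limUnder atTop a.seq

/-- `U` has Lipschitz boundary: `∂U` is an `(n-1)`-dimensional Lipschitz
submanifold without boundary, i.e. near each of its points the frontier can be
mapped by a bi-Lipschitz homeomorphism onto an open piece of a hyperplane. -/
def HasLipschitzBoundary {n : ℕ} (U : Set (EuclideanSpace ℝ (Fin n))) : Prop :=
  ∀ x ∈ frontier U, ∃ (W W' : Set (EuclideanSpace ℝ (Fin n)))
    (φ ψ : EuclideanSpace ℝ (Fin n) → EuclideanSpace ℝ (Fin n))
    (K K' : NNReal) (ℓ : EuclideanSpace ℝ (Fin n) →L[ℝ] ℝ),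
    IsOpen W ∧ x ∈ W ∧ IsOpen W' ∧ ℓ ≠ 0 ∧
    LipschitzOnWith K φ W ∧ LipschitzOnWith K' ψ W' ∧
    Set.MapsTo φ W W' ∧ Set.MapsTo ψ W' W ∧
    (∀ z ∈ W, ψ (φ z) = z) ∧ (∀ z ∈ W', φ (ψ z) = z) ∧
    φ '' (W ∩ frontier U) = W' ∩ {y | ℓ y = 0}
/-- `U` is locally strictly convex at the boundary point `x`, with the convexity
directed toward the complement of `U`: near `x` the domain is convex and the
open segment joining two distinct nearby boundary points lies inside `U`. -/
def LocallyStrictlyConvexAt {n : ℕ} (U : Set (EuclideanSpace ℝ (Fin n)))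
    (x : EuclideanSpace ℝ (Fin n)) : Prop :=
  ∃ r : ℝ, 0 < r ∧ Convex ℝ (U ∩ Metric.ball x r) ∧
    ∀ a ∈ frontier U ∩ Metric.ball x r, ∀ b ∈ frontier U ∩ Metric.ball x r,
      a ≠ b → openSegment ℝ a b ⊆ U

section IntrinsicDist

variable {n : ℕ} {U : Set (EuclideanSpace ℝ (Fin n))} {a b c : EuclideanSpace ℝ (Fin n)}

theorem intrinsicDist_le {γ : ℝ → EuclideanSpace ℝ (Fin n)} (hc : ContinuousOn γ (Icc 0 1))
    (h0 : γ 0 = a) (h1 : γ 1 = b) (hm : ∀ t ∈ Icc (0 : ℝ) 1, γ t ∈ U) :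
    intrinsicDist U a b ≤ eVariationOn γ (Icc 0 1) :=
  iInf_le_of_le γ <| iInf_le_of_le hc <| iInf_le_of_le h0 <| iInf_le_of_le h1 <| iInf_le _ hm

theorem exists_path_of_intrinsicDist_lt {L : ℝ≥0∞} (h : intrinsicDist U a b < L) :
    ∃ γ : ℝ → EuclideanSpace ℝ (Fin n), ContinuousOn γ (Icc 0 1) ∧ γ 0 = a ∧ γ 1 = b ∧
      (∀ t ∈ Icc (0 : ℝ) 1, γ t ∈ U) ∧ eVariationOn γ (Icc 0 1) < L := by
  simp only [intrinsicDist, iInf_lt_iff] at h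
  obtain ⟨γ, hc, h0, h1, hm, hL⟩ := h
  exact ⟨γ, hc, h0, h1, hm, hL⟩

theorem edist_le_intrinsicDist : edist a b ≤ intrinsicDist U a b := by
  refine le_of_forall_gt fun L hL => ?_
  obtain ⟨γ, -, h0, h1, -, hlt⟩ := exists_path_of_intrinsicDist_lt hL
  rw [← h0, ← h1]
  exact (eVariationOn.edist_le γ (by simp) (by simp)).trans_lt hlt

theorem eVariationOn_lineMap_le (a b : EuclideanSpace ℝ (Fin n)) :
    eVariationOn (AffineMap.lineMap a b : ℝ → EuclideanSpace ℝ (Fin n)) (Icc 0 1) ≤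
      edist a b := by
  have h := (lipschitzWith_lineMap (𝕜 := ℝ) a b).lipschitzOnWith (s := univ)
    |>.comp_eVariationOn_le (mapsTo_univ (id : ℝ → ℝ) (Icc 0 1))
  rw [eVariationOn_id_Icc, sub_zero, ENNReal.ofReal_one, mul_one, ← edist_nndist] at h
  exact h

theorem intrinsicDist_eq_edist (h : segment ℝ a b ⊆ U) : intrinsicDist U a b = edist a b := by
  refine le_antisymm (le_trans (intrinsicDist_le (γ := AffineMap.lineMap a b) ?_ ?_ ?_ ?_)
    (eVariationOn_lineMap_le a b)) edist_le_intrinsicDist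
  · exact AffineMap.lineMap_continuous.continuousOn
  · simp
  · simp
  · intro t ht
    exact h (segment_eq_image_lineMap ℝ a b ▸ mem_image_of_mem _ ht)

theorem intrinsicDist_self (ha : a ∈ U) : intrinsicDist U a a = 0 := by
  rw [intrinsicDist_eq_edist (by simpa using ha), edist_self]

theorem intrinsicDist_comm_le : intrinsicDist U a b ≤ intrinsicDist U b a := by
  refine le_of_forall_gt fun L hL => ?_
  obtain ⟨γ, hc, h0, h1, hm, hlt⟩ := exists_path_of_intrinsicDist_lt hL
  have hmaps : MapsTo (fun t : ℝ => 1 - t) (Icc 0 1) (Icc 0 1) := fun t ht =>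
    ⟨by linarith [ht.2], by linarith [ht.1]⟩
  refine (intrinsicDist_le (γ := γ ∘ fun t => 1 - t) (hc.comp (by fun_prop) hmaps) (by simpa)
    (by simpa) fun t ht => hm _ (hmaps ht)).trans_lt (lt_of_le_of_lt ?_ hlt)
  exact eVariationOn.comp_le_of_antitoneOn γ _ (fun x _ y _ h => sub_le_sub_left h 1) hmaps

theorem intrinsicDist_comm : intrinsicDist U a b = intrinsicDist U b a :=
  le_antisymm intrinsicDist_comm_le intrinsicDist_comm_le

/-- The distance between two points of a path inside `U` is bounded by the length of the path
between them. -/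
theorem intrinsicDist_le_of_path {γ : ℝ → EuclideanSpace ℝ (Fin n)} {s t : ℝ} (hst : s ≤ t)
    (hc : ContinuousOn γ (Icc s t)) (hm : ∀ x ∈ Icc s t, γ x ∈ U) :
    intrinsicDist U (γ s) (γ t) ≤ eVariationOn γ (Icc s t) := by
  have hmaps : MapsTo (fun x : ℝ => s + x * (t - s)) (Icc 0 1) (Icc s t) := fun x hx =>
    ⟨by nlinarith [hx.1], by nlinarith [hx.2]⟩
  refine (intrinsicDist_le (γ := γ ∘ fun x => s + x * (t - s)) (hc.comp (by fun_prop) hmaps)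
    (by simp) (by simp) fun x hx => hm _ (hmaps hx)).trans ?_
  exact eVariationOn.comp_le_of_monotoneOn γ _ (fun x _ y _ h => by
    have := sub_nonneg.2 hst
    exact add_le_add_right (mul_le_mul_of_nonneg_right h this) s) hmaps

theorem intrinsicDist_triangle (a b c : EuclideanSpace ℝ (Fin n)) :
    intrinsicDist U a c ≤ intrinsicDist U a b + intrinsicDist U b c := by
  rcases eq_or_ne (intrinsicDist U a b) ∞ with h | hab
  · simp [h]
  rcases eq_or_ne (intrinsicDist U b c) ∞ with h | hbc
  · simp [h]
  refine ENNReal.le_of_forall_pos_le_add fun ε hε _ => ?_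
  have hε2 : (ε / 2 : ℝ≥0∞) ≠ 0 := by simpa using hε.ne'
  obtain ⟨γ, hc, h0, h1, hm, hl⟩ := exists_path_of_intrinsicDist_lt (ENNReal.lt_add_right hab hε2)
  obtain ⟨σ, hc', h0', h1', hm', hl'⟩ :=
    exists_path_of_intrinsicDist_lt (ENNReal.lt_add_right hbc hε2)
  let τ : ℝ → EuclideanSpace ℝ (Fin n) := fun t => if t ≤ 1 then γ t else σ (t - 1)
  have hm1 : MapsTo (fun t : ℝ => t - 1) (Icc 1 2) (Icc 0 1) := fun t ht =>
    ⟨by linarith [ht.1], by linarith [ht.2]⟩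
  have e1 : EqOn τ γ (Icc 0 1) := fun t ht => if_pos ht.2
  have e2 : EqOn τ (σ ∘ fun t => t - 1) (Icc 1 2) := fun t ht => by
    by_cases h : t ≤ 1
    · have : t = 1 := le_antisymm h ht.1
      subst this
      simp [τ, h1, h0']
    · simp [τ, h]
  have hunion : Icc (0 : ℝ) 1 ∪ Icc 1 2 = Icc 0 2 := Icc_union_Icc_eq_Icc (by norm_num) (by norm_num)
  have hcont : ContinuousOn τ (Icc 0 2) := by
    rw [← hunion]
    exact (hc.congr e1).union_of_isClosed ((hc'.comp (by fun_prop) hm1).congr e2)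
      isClosed_Icc isClosed_Icc
  have hmem : ∀ t ∈ Icc (0 : ℝ) 2, τ t ∈ U := by
    rw [← hunion]
    rintro t (ht | ht)
    · rw [e1 ht]; exact hm t ht
    · rw [e2 ht]; exact hm' _ (hm1 ht)
  have key := intrinsicDist_le_of_path (by norm_num : (0 : ℝ) ≤ 2) hcont hmem
  have hτ0 : τ 0 = a := by simp [τ, h0]
  have hτ2 : τ 2 = c := by simp [τ]; norm_num [h1']
  rw [hτ0, hτ2] at key
  have hadd := eVariationOn.Icc_add_Icc τ (s := univ) (by norm_num : (0 : ℝ) ≤ 1)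
    (by norm_num : (1 : ℝ) ≤ 2) (mem_univ _)
  simp only [univ_inter] at hadd
  rw [← hadd, eVariationOn.eq_of_eqOn e1, eVariationOn.eq_of_eqOn e2] at key
  calc intrinsicDist U a c ≤ _ := key
    _ ≤ (intrinsicDist U a b + ε / 2) + (intrinsicDist U b c + ε / 2) :=
        add_le_add hl.le ((eVariationOn.comp_le_of_monotoneOn σ _
          (fun x _ y _ h => by simpa using h) hm1).trans hl'.le)
    _ = intrinsicDist U a b + intrinsicDist U b c + ε := by
        rw [add_add_add_comm, ENNReal.add_halves]

theorem intrinsicDist_image_le {K : NNReal} (hK0 : K ≠ 0)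
    {h : EuclideanSpace ℝ (Fin n) → EuclideanSpace ℝ (Fin n)} (hK : LipschitzWith K h)
    (hU : MapsTo h U U) : intrinsicDist U (h a) (h b) ≤ K * intrinsicDist U a b := by
  rw [mul_comm, ← ENNReal.div_le_iff_le_mul (by simp [hK0]) (by simp)]
  refine le_of_forall_gt_imp_ge_of_dense fun L hL => ?_
  rw [ENNReal.div_le_iff_le_mul (by simp [hK0]) (by simp), mul_comm]
  obtain ⟨γ, hc, h0, h1, hm, hl⟩ := exists_path_of_intrinsicDist_lt hL
  refine (intrinsicDist_le (γ := h ∘ γ) (hK.continuous.comp_continuousOn hc) (by simp [h0])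
    (by simp [h1]) fun t ht => hU (hm t ht)).trans ?_
  refine ((hK.lipschitzOnWith (s := univ)).comp_eVariationOn_le (mapsTo_univ γ _)).trans ?_
  gcongr

theorem intrinsicDist_ne_top (ho : IsOpen U) (hU : IsPreconnected U) (ha : a ∈ U) (hb : b ∈ U) :
    intrinsicDist U a b ≠ ∞ := by
  refine hU.induction₂ (fun x y => intrinsicDist U x y ≠ ∞) ?_ ?_ ?_ ha hb
  · intro x hx
    obtain ⟨r, hr, hball⟩ := Metric.isOpen_iff.1 ho x hx
    filter_upwards [mem_nhdsWithin_of_mem_nhds (ball_mem_nhds x hr)] with y hy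
    rw [intrinsicDist_eq_edist (((convex_ball x r).segment_subset (mem_ball_self hr) hy).trans hball)]
    exact edist_ne_top _ _
  · intro x y z _ _ _ hxy hyz
    exact ((intrinsicDist_triangle x y z).trans_lt (ENNReal.add_lt_top.2
      ⟨hxy.lt_top, hyz.lt_top⟩)).ne
  · intro x y _ _ h
    rwa [intrinsicDist_comm]

end IntrinsicDist

/-- A domain of `ℝⁿ` as a bundled object. -/
structure BundledDomain (n : ℕ) where
  carrier : Set (EuclideanSpace ℝ (Fin n))
  isDomainSet : IsDomainSet carrier

namespace BundledDomain

variable {n : ℕ} (D : BundledDomain n)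

theorem isOpen : IsOpen D.carrier := D.isDomainSet.1

theorem isPreconnected : IsPreconnected D.carrier := D.isDomainSet.2.isPreconnected

/-- The points of a domain, endowed with the intrinsic metric. -/
def Pt : Type := D.carrier

instance : MetricSpace D.Pt where
  dist x y := (intrinsicDist D.carrier x.1 y.1).toReal
  dist_self x := by simp [intrinsicDist_self x.2]
  dist_comm x y := by rw [intrinsicDist_comm]
  dist_triangle x y z := by
    rw [← ENNReal.toReal_add (intrinsicDist_ne_top D.isOpen D.isPreconnected x.2 y.2)
      (intrinsicDist_ne_top D.isOpen D.isPreconnected y.2 z.2)]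
    exact ENNReal.toReal_mono (ENNReal.add_ne_top.2
      ⟨intrinsicDist_ne_top D.isOpen D.isPreconnected x.2 y.2,
        intrinsicDist_ne_top D.isOpen D.isPreconnected y.2 z.2⟩) (intrinsicDist_triangle _ _ _)
  eq_of_dist_eq_zero {x y} h := by
    have h0 := (ENNReal.toReal_eq_zero_iff _).1 h |>.resolve_right
      (intrinsicDist_ne_top D.isOpen D.isPreconnected x.2 y.2)
    have : edist x.1 y.1 ≤ 0 := h0 ▸ edist_le_intrinsicDist
    exact Subtype.ext (edist_le_zero.1 this)

variable {D}

theorem Pt.dist_def (x y : D.Pt) : dist x y = (intrinsicDist D.carrier x.1 y.1).toReal := rfl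

theorem Pt.edist_def (x y : D.Pt) : edist x y = intrinsicDist D.carrier x.1 y.1 := by
  rw [edist_dist, Pt.dist_def,
    ENNReal.ofReal_toReal (intrinsicDist_ne_top D.isOpen D.isPreconnected x.2 y.2)]

theorem Pt.dist_val_le (x y : D.Pt) : dist x.1 y.1 ≤ dist x y := by
  rw [dist_edist, Pt.dist_def]
  exact ENNReal.toReal_mono (intrinsicDist_ne_top D.isOpen D.isPreconnected x.2 y.2)
    edist_le_intrinsicDist

theorem Pt.dist_eq (x y : D.Pt) (h : segment ℝ x.1 y.1 ⊆ D.carrier) :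
    dist x y = dist x.1 y.1 := by
  rw [Pt.dist_def, intrinsicDist_eq_edist h, dist_edist]

theorem Pt.exists_intermediate (x y : D.Pt) {t : ℝ} (ht : t ∈ Icc 0 (dist x y)) {η : ℝ}
    (hη : 0 < η) : ∃ z : D.Pt, dist x z = t ∧ dist z y ≤ dist x y - t + η := by
  have hlt : intrinsicDist D.carrier x.1 y.1 < ENNReal.ofReal (dist x y + η) := by
    rw [← Pt.edist_def, edist_dist]
    exact (ENNReal.ofReal_lt_ofReal_iff (by linarith [dist_nonneg (x := x) (y := y)])).2
      (by linarith)
  obtain ⟨γ, hc, h0, h1, hm, hl⟩ := exists_path_of_intrinsicDist_lt hlt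
  classical
  let σ : ℝ → D.Pt := fun s => if h : γ s ∈ D.carrier then ⟨γ s, h⟩ else x
  have hσ : ∀ s ∈ Icc (0 : ℝ) 1, (σ s).1 = γ s := fun s hs => by simp [σ, hm s hs]
  have hσ0 : σ 0 = x := Subtype.ext ((hσ 0 (by simp)).trans h0)
  have hσ1 : σ 1 = y := Subtype.ext ((hσ 1 (by simp)).trans h1)
  have hcont : ContinuousOn σ (Icc 0 1) := by
    intro s hs
    obtain ⟨r, hr, hball⟩ := Metric.isOpen_iff.1 D.isOpen (γ s) (hm s hs)
    rw [ContinuousWithinAt, tendsto_iff_dist_tendsto_zero]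
    have h2 := tendsto_iff_dist_tendsto_zero.1 (hc s hs)
    refine h2.congr' ?_
    filter_upwards [(hc s hs) (ball_mem_nhds _ hr), self_mem_nhdsWithin] with u hu hus
    have hseg : segment ℝ (σ u).1 (σ s).1 ⊆ D.carrier := by
      rw [hσ u hus, hσ s hs]
      exact ((convex_ball _ _).segment_subset hu (mem_ball_self hr)).trans hball
    rw [Pt.dist_eq _ _ hseg, hσ u hus, hσ s hs]
  have hivt := intermediate_value_Icc (f := fun s => dist x (σ s)) zero_le_one
    (by fun_prop)
  simp only [hσ0, hσ1, dist_self] at hivt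
  obtain ⟨s, hs, hst⟩ := hivt ht
  refine ⟨σ s, hst, ?_⟩
  have e1 : intrinsicDist D.carrier x.1 (γ s) ≤ eVariationOn γ (Icc 0 s) := by
    rw [← h0]
    exact intrinsicDist_le_of_path hs.1 (hc.mono (Icc_subset_Icc_right hs.2))
      fun u hu => hm u ⟨hu.1, hu.2.trans hs.2⟩
  have e2 : intrinsicDist D.carrier (γ s) y.1 ≤ eVariationOn γ (Icc s 1) := by
    rw [← h1]
    exact intrinsicDist_le_of_path hs.2 (hc.mono (Icc_subset_Icc_left hs.1))
      fun u hu => hm u ⟨hs.1.trans hu.1, hu.2⟩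
  have hadd := eVariationOn.Icc_add_Icc γ (s := univ) hs.1 hs.2 (mem_univ _)
  simp only [univ_inter] at hadd
  have e3 := (add_le_add e1 e2).trans (hadd.trans_lt hl).le
  rw [← hσ s hs, ← Pt.edist_def, ← Pt.edist_def, edist_dist, edist_dist,
    ← ENNReal.ofReal_add dist_nonneg dist_nonneg, ENNReal.ofReal_le_ofReal_iff
      (by linarith [dist_nonneg (x := x) (y := y)])] at e3
  linarith

variable (D) in
/-- The completion of a domain with respect to its intrinsic metric. -/
abbrev Hull : Type := UniformSpace.Completion D.Pt

/-- A point of the domain as a point of the completion. -/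
def pt (x : EuclideanSpace ℝ (Fin n)) (hx : x ∈ D.carrier) : D.Hull :=
  UniformSpace.Completion.coe' (α := D.Pt) ⟨x, hx⟩

theorem dist_coe (x y : D.Pt) : dist (pt x.1 x.2) (pt y.1 y.2) = dist x y :=
  UniformSpace.Completion.dist_eq x y

theorem dist_pt {x y : EuclideanSpace ℝ (Fin n)} (hx : x ∈ D.carrier) (hy : y ∈ D.carrier) :
    dist (pt x hx) (pt y hy) = (intrinsicDist D.carrier x y).toReal :=
  dist_coe ⟨x, hx⟩ ⟨y, hy⟩

theorem dist_pt_eq {x y : EuclideanSpace ℝ (Fin n)} (hx : x ∈ D.carrier) (hy : y ∈ D.carrier)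
    (h : segment ℝ x y ⊆ D.carrier) : dist (pt x hx) (pt y hy) = dist x y :=
  (dist_coe ⟨x, hx⟩ ⟨y, hy⟩).trans (Pt.dist_eq _ _ h)

variable (D) in
/-- The Hausdorff boundary, as a subset of the completion. -/
def bdry : Set D.Hull := {p | ∀ x hx, pt x hx ≠ p}

/-- The Euclidean point underlying a point of the completion. -/
def supp : D.Hull → EuclideanSpace ℝ (Fin n) :=
  UniformSpace.Completion.extension (fun x : D.Pt => x.1)

theorem lipschitzWith_val : LipschitzWith 1 (fun x : D.Pt => x.1) :=
  LipschitzWith.of_dist_le_mul fun x y => by simpa using Pt.dist_val_le x y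

theorem lipschitzWith_supp : LipschitzWith 1 (supp (D := D)) :=
  lipschitzWith_val.completion_extension

theorem continuous_supp : Continuous (supp (D := D)) := lipschitzWith_supp.continuous

theorem dist_supp_le (p q : D.Hull) : dist (supp p) (supp q) ≤ dist p q := by
  simpa using lipschitzWith_supp.dist_le_mul p q

@[simp] theorem supp_pt {x : EuclideanSpace ℝ (Fin n)} (hx : x ∈ D.carrier) :
    supp (pt x hx) = x :=
  UniformSpace.Completion.extension_coe lipschitzWith_val.uniformContinuous (⟨x, hx⟩ : D.Pt)

theorem exists_seq_tendsto (p : D.Hull) : ∃ x : ℕ → EuclideanSpace ℝ (Fin n),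
    ∃ hx : ∀ k, x k ∈ D.carrier, Tendsto (fun k => pt (x k) (hx k)) atTop (𝓝 p) := by
  obtain ⟨u, hu, hlim⟩ := mem_closure_iff_seq_limit.1
    (UniformSpace.Completion.denseRange_coe (α := D.Pt) p)
  choose v hv using hu
  exact ⟨fun k => (v k).1, fun k => (v k).2, hlim.congr fun k => (hv k).symm⟩

theorem exists_pt_dist_lt (p : D.Hull) {ε : ℝ} (hε : 0 < ε) :
    ∃ x, ∃ hx : x ∈ D.carrier, dist p (pt x hx) < ε := by
  obtain ⟨x, hx, hlim⟩ := exists_seq_tendsto p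
  obtain ⟨k, hk⟩ := (hlim.eventually (ball_mem_nhds p hε)).exists
  exact ⟨x k, hx k, by rw [dist_comm]; exact hk⟩

theorem tendsto_of_tendsto_pt {p : D.Hull} {x : ℕ → EuclideanSpace ℝ (Fin n)}
    {hx : ∀ k, x k ∈ D.carrier} (h : Tendsto (fun k => pt (x k) (hx k)) atTop (𝓝 p)) :
    Tendsto x atTop (𝓝 (supp p)) :=
  ((continuous_supp.tendsto p).comp h).congr fun k => by simp

theorem supp_mem_closure (p : D.Hull) : supp p ∈ closure D.carrier := by
  obtain ⟨x, hx, hlim⟩ := exists_seq_tendsto p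
  exact mem_closure_of_tendsto (tendsto_of_tendsto_pt hlim) (Eventually.of_forall hx)

theorem tendsto_pt {x : ℕ → EuclideanSpace ℝ (Fin n)} {hx : ∀ k, x k ∈ D.carrier}
    {y : EuclideanSpace ℝ (Fin n)} (hy : y ∈ D.carrier) (h : Tendsto x atTop (𝓝 y)) :
    Tendsto (fun k => pt (x k) (hx k)) atTop (𝓝 (pt y hy)) := by
  obtain ⟨r, hr, hball⟩ := Metric.isOpen_iff.1 D.isOpen y hy
  rw [tendsto_iff_dist_tendsto_zero] at h ⊢
  refine h.congr' ?_
  filter_upwards [h (gt_mem_nhds hr)] with k hk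
  exact (dist_pt_eq _ _ (((convex_ball y r).segment_subset hk (mem_ball_self hr)).trans hball)).symm

theorem eq_pt_of_supp_mem {p : D.Hull} (hp : supp p ∈ D.carrier) : p = pt (supp p) hp := by
  obtain ⟨x, hx, hlim⟩ := exists_seq_tendsto p
  exact tendsto_nhds_unique hlim (tendsto_pt hp (tendsto_of_tendsto_pt hlim))

theorem mem_bdry_iff {p : D.Hull} : p ∈ D.bdry ↔ supp p ∉ D.carrier :=
  ⟨fun h hp => h _ hp (eq_pt_of_supp_mem hp).symm, fun h x hx hxp => h (by rwa [← hxp, supp_pt])⟩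

theorem supp_mem_frontier {p : D.Hull} (hp : p ∈ D.bdry) : supp p ∈ frontier D.carrier := by
  rw [D.isOpen.frontier_eq]
  exact ⟨supp_mem_closure p, mem_bdry_iff.1 hp⟩

theorem exists_intermediate_pt {x y : EuclideanSpace ℝ (Fin n)} (hx : x ∈ D.carrier)
    (hy : y ∈ D.carrier) {t : ℝ} (ht : t ∈ Icc 0 (dist (pt x hx) (pt y hy))) {η : ℝ} (hη : 0 < η) :
    ∃ z, ∃ hz : z ∈ D.carrier, dist (pt x hx) (pt z hz) = t ∧
      dist (pt z hz) (pt y hy) ≤ dist (pt x hx) (pt y hy) - t + η := by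
  have hxy := dist_coe (D := D) ⟨x, hx⟩ ⟨y, hy⟩
  obtain ⟨z, h1, h2⟩ := Pt.exists_intermediate (D := D) ⟨x, hx⟩ ⟨y, hy⟩ (hxy ▸ ht) hη
  refine ⟨z.1, z.2, (dist_coe ⟨x, hx⟩ z).trans h1, (dist_coe z ⟨y, hy⟩).trans_le (h2.trans_eq ?_)⟩
  rw [← hxy]

theorem exists_intermediate (p q : D.Hull) {t : ℝ} (ht : t ∈ Icc 0 (dist p q)) {η : ℝ}
    (hη : 0 < η) : ∃ z, ∃ hz : z ∈ D.carrier,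
      dist p (pt z hz) ≤ t + η ∧ dist (pt z hz) q ≤ dist p q - t + η := by
  obtain ⟨x, hx, hpx⟩ := exists_pt_dist_lt p (by positivity : 0 < η / 8)
  obtain ⟨y, hy, hqy⟩ := exists_pt_dist_lt q (by positivity : 0 < η / 8)
  obtain ⟨z, hz, hz1, hz2⟩ := exists_intermediate_pt hx hy
    (t := min t (dist (pt x hx) (pt y hy))) ⟨le_min ht.1 dist_nonneg, min_le_right _ _⟩
    (by positivity : 0 < η / 8)
  have t1 := dist_triangle p (pt x hx) (pt z hz)
  have t2 := dist_triangle (pt z hz) (pt y hy) q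
  have t3 := dist_triangle4 (pt x hx) p q (pt y hy)
  have t4 := ht.2
  rw [dist_comm] at hqy
  rw [dist_comm (pt x hx) p, dist_comm q] at t3
  refine ⟨z, hz, ?_, ?_⟩
  · linarith [min_le_left t (dist (pt x hx) (pt y hy))]
  · rcases min_choice t (dist (pt x hx) (pt y hy)) with h | h <;> rw [h] at hz2 <;> linarith

/-- A boundary point that can be reached along a half-open segment. -/
theorem exists_bdry_of_openSegment {w y : EuclideanSpace ℝ (Fin n)} (hw : w ∈ D.carrier)
    (hy : y ∉ D.carrier) (h : openSegment ℝ w y ⊆ D.carrier) :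
    ∃ p ∈ D.bdry, supp p = y ∧ ∀ z (hz : z ∈ D.carrier), z ∈ segment ℝ w y →
      dist (pt z hz) p = dist z y := by
  set L : ℝ → EuclideanSpace ℝ (Fin n) := fun t => AffineMap.lineMap w y t with hL
  have hLD : L '' Ico 0 1 ⊆ D.carrier := by
    rintro _ ⟨t, ht, rfl⟩
    rcases ht.1.eq_or_lt with rfl | h0
    · simpa [hL] using hw
    · exact h (openSegment_eq_image_lineMap ℝ w y ▸ mem_image_of_mem _ ⟨h0, ht.2⟩)
  have hconv : Convex ℝ (L '' Ico 0 1) :=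
    (convex_Ico (0 : ℝ) 1).affine_image (AffineMap.lineMap (k := ℝ) w y)
  have hpar : ∀ z ∈ D.carrier, z ∈ segment ℝ w y → z ∈ L '' Ico 0 1 := by
    intro z hz hzs
    rw [segment_eq_image_lineMap] at hzs
    obtain ⟨t, ht, rfl⟩ := hzs
    refine ⟨t, ⟨ht.1, lt_of_le_of_ne ht.2 ?_⟩, rfl⟩
    rintro rfl
    simp at hz
    exact hy hz
  have hdist : ∀ z (hz : z ∈ D.carrier) z' (hz' : z' ∈ D.carrier), z ∈ L '' Ico 0 1 →
      z' ∈ L '' Ico 0 1 → dist (pt z hz) (pt z' hz') = dist z z' := fun z hz z' hz' h1 h2 =>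
    dist_pt_eq hz hz' ((hconv.segment_subset h1 h2).trans hLD)
  let u : ℕ → ℝ := fun k => 1 - 1 / ((k : ℝ) + 1)
  have hu : ∀ k, u k ∈ Ico (0 : ℝ) 1 := fun k => by
    have h1 : 1 / ((k : ℝ) + 1) ≤ 1 := by
      rw [div_le_one (by positivity)]
      linarith [k.cast_nonneg (α := ℝ)]
    have h2 : 0 < 1 / ((k : ℝ) + 1) := by positivity
    constructor <;> simp only [u] <;> linarith
  have hmem : ∀ k, L (u k) ∈ L '' Ico 0 1 := fun k => mem_image_of_mem _ (hu k)
  have hulim : Tendsto u atTop (𝓝 1) := by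
    simpa [u] using (tendsto_one_div_add_atTop_nhds_zero_nat (𝕜 := ℝ)).const_sub 1
  have hlim : Tendsto (fun k => L (u k)) atTop (𝓝 y) := by
    have : Tendsto L (𝓝 1) (𝓝 (L 1)) := AffineMap.lineMap_continuous.tendsto 1
    simpa [hL, Function.comp_def] using this.comp hulim
  have hcauchy : CauchySeq fun k => pt (L (u k)) (hLD (hmem k)) := by
    rw [Metric.cauchySeq_iff]
    intro ε hε
    obtain ⟨N, hN⟩ := Metric.cauchySeq_iff.1 hlim.cauchySeq ε hε
    exact ⟨N, fun i hi j hj => by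
      rw [hdist _ _ _ _ (hmem i) (hmem j)]; exact hN i hi j hj⟩
  obtain ⟨p, hp⟩ := cauchySeq_tendsto_of_complete hcauchy
  have hsupp : supp p = y := tendsto_nhds_unique (tendsto_of_tendsto_pt hp) hlim
  refine ⟨p, mem_bdry_iff.2 (hsupp ▸ hy), hsupp, fun z hz hzs => ?_⟩
  refine tendsto_nhds_unique (tendsto_const_nhds.dist hp) ((tendsto_const_nhds.dist hlim).congr ?_)
  intro k
  exact (hdist z hz _ _ (hpar z hz hzs) (hmem k)).symm

/-- If the Euclidean ball of radius `r` around `w` leaves the domain, there is a point of the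
Hausdorff boundary at intrinsic distance less than `r`, on a segment starting at `w`. -/
theorem exists_bdry_dist_lt {w : EuclideanSpace ℝ (Fin n)} (hw : w ∈ D.carrier) {r : ℝ}
    (h : ¬ ball w r ⊆ D.carrier) : ∃ p ∈ D.bdry, dist (pt w hw) p < r := by
  obtain ⟨y, hyr, hy⟩ := not_subset.1 h
  have hLc : Continuous (AffineMap.lineMap w y : ℝ → EuclideanSpace ℝ (Fin n)) :=
    AffineMap.lineMap_continuous
  let S : Set ℝ := Icc 0 1 ∩ (AffineMap.lineMap w y : ℝ → EuclideanSpace ℝ (Fin n)) ⁻¹' D.carrierᶜ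
  have hS : IsCompact S :=
    isCompact_Icc.inter_right (D.isOpen.isClosed_compl.preimage hLc)
  obtain ⟨t, ⟨ht, htD⟩, hmin⟩ := hS.exists_isLeast ⟨1, by simp [S, hy]⟩
  have hpos : 0 < t := lt_of_le_of_ne ht.1 (by rintro rfl; simp [hw] at htD)
  obtain ⟨p, hp, -, hdist⟩ := exists_bdry_of_openSegment (D := D) hw htD (by
    intro z hz
    rw [openSegment_eq_image_lineMap] at hz
    obtain ⟨s, hs, rfl⟩ := hz
    rw [AffineMap.lineMap_lineMap_right]
    by_contra hcon
    have := hmin (a := s * t) ⟨⟨by nlinarith [hs.1], by nlinarith [hs.2, ht.2]⟩, hcon⟩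
    nlinarith [hs.2])
  refine ⟨p, hp, ?_⟩
  rw [hdist w hw (left_mem_segment ℝ _ _), dist_left_lineMap, Real.norm_of_nonneg ht.1]
  rw [mem_ball, dist_comm] at hyr
  nlinarith [ht.2, dist_nonneg (x := w) (y := y)]

end BundledDomain

theorem eq_add_sub_of_dist_eq {E : Type*} [NormedAddCommGroup E] [InnerProductSpace ℝ E]
    {x y z : E} {h : ℝ} (hxy : dist x y ≤ h) (hyz : dist y z ≤ h) (hxz : 2 * h ≤ dist x z) :
    z = y + (y - x) := by
  have hpar := parallelogram_law_with_norm ℝ (z - y) (y - x)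
  rw [sub_add_sub_cancel, ← dist_eq_norm z x, ← dist_eq_norm z y, ← dist_eq_norm y x,
    dist_comm z x, dist_comm z y, dist_comm y x] at hpar
  have h0 : ‖z - y - (y - x)‖ = 0 := by
    have := dist_nonneg (x := x) (y := y)
    have := dist_nonneg (x := y) (y := z)
    have := norm_nonneg (z - y - (y - x))
    by_contra hne
    have : 0 < ‖z - y - (y - x)‖ := lt_of_le_of_ne this (Ne.symm hne)
    nlinarith
  rw [norm_eq_zero, sub_eq_zero] at h0
  rw [← h0]
  abel

namespace BundledDomain

variable {n : ℕ} {D : BundledDomain n}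

/-- `p` and `q` cannot be almost joined by a shortest path through the Hausdorff boundary. -/
def BoundaryAvoiding (p q : D.Hull) : Prop :=
  ∀ δ > 0, ∃ η > 0, ∀ v ∈ D.bdry, δ ≤ dist p v → δ ≤ dist v q → dist p q + η < dist p v + dist v q

theorem BoundaryAvoiding.exists_ball_subset {p q : D.Hull} (h : BoundaryAvoiding p q) {δ : ℝ}
    (hδ : 0 < δ) : ∃ r > 0, ∀ z (hz : z ∈ D.carrier), dist p (pt z hz) + dist (pt z hz) q ≤
      dist p q + r → δ ≤ dist p (pt z hz) → δ ≤ dist (pt z hz) q → ball z r ⊆ D.carrier := by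
  obtain ⟨η, hη, H⟩ := h (δ / 2) (by positivity)
  refine ⟨min (δ / 2) (η / 3), by positivity, fun z hz h1 h2 h3 => ?_⟩
  by_contra hcon
  obtain ⟨v, hv, hlt⟩ := exists_bdry_dist_lt hz hcon
  have a1 := lt_of_lt_of_le hlt (min_le_left _ _)
  have a2 := lt_of_lt_of_le hlt (min_le_right _ _)
  have a3 := min_le_right (δ / 2) (η / 3)
  have t1 := dist_triangle p v (pt z hz)
  have t2 := dist_triangle (pt z hz) v q
  have t3 := dist_triangle p (pt z hz) v
  have t4 := dist_triangle v (pt z hz) q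
  rw [dist_comm v (pt z hz)] at t1 t4
  have := H v hv (by linarith) (by linarith)
  linarith

/-- Points on shortest paths exist in the domain. -/
theorem BoundaryAvoiding.exists_between {p q : D.Hull} (h : BoundaryAvoiding p q) {s : D.Hull}
    {u t : ℝ} (hps : dist p s = u) (hsq : dist s q = dist p q - u) (hut : u < t)
    (htd : t < dist p q) : ∃ w, ∃ hw : w ∈ D.carrier, dist s (pt w hw) = t - u ∧
      dist (pt w hw) q = dist p q - t ∧ dist p (pt w hw) = t := by
  have hu : 0 ≤ u := hps ▸ dist_nonneg
  obtain ⟨r, hr, hball⟩ := h.exists_ball_subset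
    (δ := min t (dist p q - t) / 2) (half_pos (lt_min (by linarith) (by linarith)))
  set δ := min t (dist p q - t) / 2 with hδ
  have hδ1 : δ ≤ t / 2 := by rw [hδ]; gcongr; exact min_le_left _ _
  have hδ2 : δ ≤ (dist p q - t) / 2 := by rw [hδ]; gcongr; exact min_le_right _ _
  have hδ0 : 0 < δ := half_pos (lt_min (by linarith) (by linarith))
  let ε : ℕ → ℝ := fun k => min δ (r / 2) * (1 / ((k : ℝ) + 1))
  have hm : 0 < min δ (r / 2) := by positivity
  have hε0 : ∀ k, 0 < ε k := fun k => by positivity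
  have hεle : ∀ k, ε k ≤ min δ (r / 2) := fun k => by
    have h1 : 1 / ((k : ℝ) + 1) ≤ 1 := by
      rw [div_le_one (by positivity)]
      linarith [k.cast_nonneg (α := ℝ)]
    exact mul_le_of_le_one_right hm.le h1
  have hεlim : Tendsto ε atTop (𝓝 0) := by
    simpa [ε] using (tendsto_one_div_add_atTop_nhds_zero_nat (𝕜 := ℝ)).const_mul (min δ (r / 2))
  have hex := fun k => exists_intermediate s q (t := t - u) ⟨by linarith, by rw [hsq]; linarith⟩
    (hε0 k)
  choose z hz hz1 hz2 using hex
  rw [hsq] at hz2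
  have hpz : ∀ k, dist p (pt (z k) (hz k)) ≤ t + ε k := fun k => by
    linarith [dist_triangle p s (pt (z k) (hz k)), hz1 k]
  have hb : ∀ k, ball (z k) r ⊆ D.carrier := fun k => by
    have e1 := (hεle k).trans (min_le_left _ _)
    have e2 := (hεle k).trans (min_le_right _ _)
    have e3 := hz2 k
    have e4 := dist_triangle p (pt (z k) (hz k)) q
    have e5 := hpz k
    exact hball _ (hz k) (by linarith) (by linarith) (by linarith)
  obtain ⟨w, -, φ, hφ, hlim⟩ := tendsto_subseq_of_bounded
    (isBounded_closedBall (x := supp q) (r := dist p q + δ)) (x := z) fun k => by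
      rw [mem_closedBall]
      have e0 := dist_supp_le (pt (z k) (hz k)) q
      rw [supp_pt] at e0
      linarith [hz2 k, (hεle k).trans (min_le_left _ _)]
  have hw : w ∈ D.carrier := by
    obtain ⟨k, hk⟩ := (hlim.eventually (ball_mem_nhds w hr)).exists
    exact hb (φ k) (by rw [mem_ball, dist_comm]; exact hk)
  have hlim2 : Tendsto (fun k => pt (z (φ k)) (hz (φ k))) atTop (𝓝 (pt w hw)) :=
    tendsto_pt (hx := fun k => hz (φ k)) hw hlim
  have hεφ := hεlim.comp hφ.tendsto_atTop
  have l1 : dist s (pt w hw) ≤ t - u := by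
    simpa using le_of_tendsto_of_tendsto' (tendsto_const_nhds.dist hlim2)
      (hεφ.const_add (t - u)) fun k => hz1 (φ k)
  have l2 : dist (pt w hw) q ≤ dist p q - u - (t - u) := by
    simpa using le_of_tendsto_of_tendsto' (hlim2.dist tendsto_const_nhds)
      (hεφ.const_add (dist p q - u - (t - u))) fun k => hz2 (φ k)
  have t1 := dist_triangle p s (pt w hw)
  have t2 := dist_triangle p (pt w hw) q
  exact ⟨w, hw, by linarith, by linarith, by linarith⟩

theorem BoundaryAvoiding.dist_supp {p q : D.Hull} (h : BoundaryAvoiding p q) :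
    dist (supp p) (supp q) = dist p q := by
  refine le_antisymm (dist_supp_le p q) ?_
  by_contra! hlt
  have hd : 0 < dist p q := lt_of_le_of_lt dist_nonneg hlt
  obtain ⟨δ, hδ, hδd⟩ : ∃ δ > 0, dist (supp p) (supp q) < dist p q - 4 * δ :=
    ⟨(dist p q - dist (supp p) (supp q)) / 8, by linarith, by linarith⟩
  have hδ4 : 4 * δ < dist p q := by linarith [dist_nonneg (x := supp p) (y := supp q)]
  obtain ⟨r, hr, hball⟩ := h.exists_ball_subset hδ
  obtain ⟨N, hN⟩ := exists_nat_gt ((dist p q - 2 * δ) / r)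
  have hN0 : (0 : ℝ) < N := lt_of_le_of_lt (div_nonneg (by linarith) hr.le) hN
  set η := (dist p q - 2 * δ) / N with hη
  have hη0 : 0 < η := div_pos (by linarith) hN0
  have hηr : η < r := by
    rw [hη, div_lt_iff₀ hN0]
    rw [div_lt_iff₀ hr] at hN
    linarith
  have hNη : N * η = dist p q - 2 * δ := by rw [hη]; field_simp
  have hloc : ∀ x (hx : x ∈ D.carrier) y (hy : y ∈ D.carrier), ball x r ⊆ D.carrier →
      dist (pt x hx) (pt y hy) < r → dist x y = dist (pt x hx) (pt y hy) := by
    intro x hx y hy hb hxy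
    refine (dist_pt_eq hx hy (((convex_ball x r).segment_subset (mem_ball_self hr) ?_).trans hb)).symm
    have := dist_supp_le (pt x hx) (pt y hy)
    rw [supp_pt, supp_pt] at this
    rw [mem_ball, dist_comm]
    linarith
  have chain : ∀ i : ℕ, i < N → ∃ z e : EuclideanSpace ℝ (Fin n), ‖e‖ = η ∧ dist (supp p) z ≤ δ ∧
      ∃ hx : z + (i : ℝ) • e ∈ D.carrier, ∃ hy : z + ((i : ℝ) + 1) • e ∈ D.carrier,
        dist p (pt _ hx) = δ + i * η ∧
        dist p (pt _ hy) = δ + (i + 1) * η ∧ dist (pt _ hy) q = dist p q - (δ + (i + 1) * η) := by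
    intro i
    induction i with
    | zero =>
      intro hi
      have h1N : (1 : ℝ) ≤ N := by exact_mod_cast hi
      obtain ⟨x, hx, h1, h2, h3⟩ := h.exists_between (s := p) (u := 0) (t := δ) (dist_self p)
        (by simp) hδ (by linarith)
      obtain ⟨y, hy, g1, g2, g3⟩ := h.exists_between (t := δ + η) h3 h2 (by linarith)
        (by nlinarith)
      have hxb := hball x hx (by linarith) (by linarith) (by linarith)
      have hxy := hloc x hx y hy hxb (by linarith)
      have e1 : x + ((0 : ℕ) : ℝ) • (y - x) = x := by simp
      have e2 : x + (((0 : ℕ) : ℝ) + 1) • (y - x) = y := by simp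
      refine ⟨x, y - x, ?_, ?_, ?_⟩
      · rw [← dist_eq_norm, dist_comm, hxy]; linarith
      · have := dist_supp_le p (pt x hx)
        rw [supp_pt] at this
        linarith
      · simp only [e1, e2]
        refine ⟨hx, hy, ?_, ?_, ?_⟩ <;> push_cast <;> linarith
    | succ i ih =>
      intro hi
      obtain ⟨z, e, he, hz, hx, hy, h1, h2, h3⟩ := ih (by omega)
      have hiN : (i : ℝ) + 1 + 1 ≤ N := by exact_mod_cast hi
      have hiη : ((i : ℝ) + 1 + 1) * η ≤ N * η := by gcongr
      have hi0 : 0 ≤ (i : ℝ) * η := by positivity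
      obtain ⟨w, hw, g1, g2, g3⟩ := h.exists_between (t := δ + (i + 1 + 1) * η) h2 h3
        (by linarith) (by linarith)
      have hyb := hball _ hy (by linarith) (by linarith) (by linarith)
      have hyw := hloc _ hy w hw hyb (by linarith)
      have hexy : dist (z + (i : ℝ) • e) (z + ((i : ℝ) + 1) • e) = η := by
        rw [dist_eq_norm, ← he, ← norm_neg e]
        congr 1
        module
      have hxw : dist (z + (i : ℝ) • e) w = dist (pt _ hx) (pt w hw) := by
        refine (dist_pt_eq hx hw (((convex_ball (z + ((i : ℝ) + 1) • e) r).segment_subset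
          ?_ ?_).trans hyb)).symm
        · rw [mem_ball, hexy]; exact hηr
        · rw [mem_ball, dist_comm]; linarith
      have hwe := eq_add_sub_of_dist_eq (x := z + (i : ℝ) • e) (y := z + ((i : ℝ) + 1) • e) (z := w)
        (h := η) hexy.le (by linarith) (by
          rw [hxw]; linarith [dist_triangle p (pt _ hx) (pt w hw)])
      have hwe2 : w = z + (((i + 1 : ℕ) : ℝ) + 1) • e := by
        rw [hwe]; push_cast; module
      have hxe2 : z + ((i + 1 : ℕ) : ℝ) • e = z + ((i : ℝ) + 1) • e := by push_cast; rfl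
      refine ⟨z, e, he, hz, ?_⟩
      simp only [hxe2, ← hwe2]
      refine ⟨hy, hw, ?_, ?_, ?_⟩ <;> push_cast <;> linarith
  obtain ⟨M, rfl⟩ : ∃ M, N = M + 1 := Nat.exists_eq_succ_of_ne_zero (by
    rintro rfl; simp at hN0)
  obtain ⟨z, e, he, hz, hx, hy, h1, h2, h3⟩ := chain M (by omega)
  push_cast at hNη
  have a1 := dist_supp_le (pt _ hy) q
  rw [supp_pt] at a1
  have a2 : dist z (z + ((M : ℝ) + 1) • e) = (M + 1) * η := by
    rw [dist_self_add_right, norm_smul, he, Real.norm_of_nonneg (by positivity)]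
  have a3 := dist_triangle4 z (supp p) (supp q) (z + ((M : ℝ) + 1) • e)
  rw [dist_comm z (supp p), dist_comm (supp q)] at a3
  linarith

theorem BoundaryAvoiding.openSegment_subset {p q : D.Hull} (h : BoundaryAvoiding p q)
    (hpq : 0 < dist p q) : openSegment ℝ (supp p) (supp q) ⊆ D.carrier := by
  rw [openSegment_eq_image_lineMap]
  rintro _ ⟨t, ht, rfl⟩
  obtain ⟨w, hw, -, h2, h3⟩ := h.exists_between (s := p) (u := 0) (t := t * dist p q) (dist_self p)
    (by simp) (mul_pos ht.1 hpq) (mul_lt_of_lt_one_left hpq ht.2)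
  have a1 := dist_supp_le p (pt w hw)
  have a2 := dist_supp_le (pt w hw) q
  rw [supp_pt] at a1 a2
  have a3 := dist_triangle (supp p) w (supp q)
  have a4 := h.dist_supp
  have : w = AffineMap.lineMap (supp p) (supp q) t :=
    eq_lineMap_of_dist_eq_mul_of_dist_eq_mul (by rw [a4]; linarith) (by rw [a4]; linarith)
  rwa [← this]

end BundledDomain

section LocallyStrictlyConvex

variable {n : ℕ} {U : Set (EuclideanSpace ℝ (Fin n))} {P : EuclideanSpace ℝ (Fin n)}

theorem LocallyStrictlyConvexAt.not_openSegment_subset_closure (ho : IsOpen U)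
    {y p q : EuclideanSpace ℝ (Fin n)} (hy : y ∈ frontier U) (h : LocallyStrictlyConvexAt U y)
    (hpq : p ≠ q) (hypq : y ∈ openSegment ℝ p q) : ¬ openSegment ℝ p q ⊆ closure U := by
  intro hsub
  obtain ⟨r, hr, hconv, hstrict⟩ := h
  rw [ho.frontier_eq] at hy
  rw [openSegment_eq_image_lineMap] at hypq hsub
  obtain ⟨t, ht, rfl⟩ := hypq
  set L : ℝ → EuclideanSpace ℝ (Fin n) := fun t => AffineMap.lineMap p q t with hL
  have hLc : Continuous L := AffineMap.lineMap_continuous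
  have hnhds : Ioo (0 : ℝ) 1 ∩ L ⁻¹' ball (L t) r ∈ 𝓝 t :=
    inter_mem (Ioo_mem_nhds ht.1 ht.2) (hLc.continuousAt (ball_mem_nhds _ hr))
  obtain ⟨δ, hδ, hball⟩ := Metric.mem_nhds_iff.1 hnhds
  have hmem : ∀ s, |s - t| < δ → L s ∈ closure U ∩ ball (L t) r := fun s hs =>
    have := hball (show s ∈ ball t δ by rwa [mem_ball, Real.dist_eq])
    ⟨hsub (mem_image_of_mem _ this.1), this.2⟩
  have h1 := hmem (t - δ / 2) (by rw [abs_lt]; constructor <;> linarith)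
  have h2 := hmem (t + δ / 2) (by rw [abs_lt]; constructor <;> linarith)
  have hmid : L t ∈ openSegment ℝ (L (t - δ / 2)) (L (t + δ / 2)) := by
    refine ⟨1 / 2, 1 / 2, by norm_num, by norm_num, by norm_num, ?_⟩
    simp only [hL, AffineMap.lineMap_apply_module]
    module
  have hne : L (t - δ / 2) ≠ L (t + δ / 2) := fun h => by
    have := AffineMap.lineMap_injective ℝ hpq h
    linarith
  have hcl : ∀ z ∈ closure U ∩ ball (L t) r, z ∈ closure (U ∩ ball (L t) r) := fun z hz => by
    rw [inter_comm]
    exact isOpen_ball.inter_closure ⟨hz.2, hz.1⟩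
  have hinter : interior (U ∩ ball (L t) r) = U ∩ ball (L t) r :=
    (ho.inter isOpen_ball).interior_eq
  by_cases hp' : L (t - δ / 2) ∈ U
  · have := hconv.openSegment_interior_closure_subset_interior
      (x := L (t - δ / 2)) (hinter.symm ▸ ⟨hp', h1.2⟩) (hcl _ h2) hmid
    exact hy.2 (interior_subset this).1
  by_cases hq' : L (t + δ / 2) ∈ U
  · rw [openSegment_symm] at hmid
    have := hconv.openSegment_interior_closure_subset_interior
      (x := L (t + δ / 2)) (hinter.symm ▸ ⟨hq', h2.2⟩) (hcl _ h1) hmid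
    exact hy.2 (interior_subset this).1
  have hf : frontier U = closure U \ U := ho.frontier_eq
  exact hy.2 (hstrict _ ⟨hf ▸ ⟨h1.1, hp'⟩, h1.2⟩ _ ⟨hf ▸ ⟨h2.1, hq'⟩, h2.2⟩ hne hmid)

theorem openSegment_subset_of_subset_closure (ho : IsOpen U)
    (hlsc : ∀ x ∈ frontier U \ {P}, LocallyStrictlyConvexAt U x)
    {p q : EuclideanSpace ℝ (Fin n)} (hpq : p ≠ q) (hP : P ∉ openSegment ℝ p q)
    (h : openSegment ℝ p q ⊆ closure U) : openSegment ℝ p q ⊆ U := by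
  intro y hy
  by_contra hyU
  have hyf : y ∈ frontier U := ho.frontier_eq ▸ ⟨h hy, hyU⟩
  exact (hlsc y ⟨hyf, fun hyP => hP (hyP ▸ hy)⟩).not_openSegment_subset_closure ho hyf hpq hy h

theorem isClosed_setOf_segment_subset {E : Type*} [NormedAddCommGroup E] [NormedSpace ℝ E]
    {F : Set E} (hF : IsClosed F) : IsClosed {z : E × E | segment ℝ z.1 z.2 ⊆ F} := by
  have : {z : E × E | segment ℝ z.1 z.2 ⊆ F} =
      ⋂ t ∈ Icc (0 : ℝ) 1, {z : E × E | AffineMap.lineMap z.1 z.2 t ∈ F} := by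
    ext z
    simp only [mem_iInter, segment_eq_image_lineMap]
    exact image_subset_iff
  rw [this]
  refine isClosed_biInter fun t _ => hF.preimage ?_
  simp only [AffineMap.lineMap_apply_module]
  fun_prop

theorem isOpen_setOf_segment_subset {E : Type*} [NormedAddCommGroup E] [NormedSpace ℝ E]
    {O : Set E} (hO : IsOpen O) : IsOpen {z : E × E | segment ℝ z.1 z.2 ⊆ O} := by
  rw [isOpen_iff_mem_nhds]
  intro z hz
  have hcont : Continuous fun w : (E × E) × ℝ => (1 - w.2) • w.1.1 + w.2 • w.1.2 := by fun_prop
  have := isCompact_Icc.eventually_forall_of_forall_eventually (x₀ := z)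
    (K := Icc (0 : ℝ) 1) (P := fun z t => (1 - t) • z.1 + t • z.2 ∈ O) (fun t ht =>
      hcont.continuousAt (hO.mem_nhds (hz (by
        rw [segment_eq_image]; exact mem_image_of_mem _ ht))))
  filter_upwards [this] with w hw
  rw [segment_eq_image]
  rintro _ ⟨t, ht, rfl⟩
  exact hw t ht

theorem segment_subset_of_openSegment_subset {E : Type*} [AddCommGroup E] [Module ℝ E]
    {O : Set E} {x y : E} (hx : x ∈ O) (hy : y ∈ O) (h : openSegment ℝ x y ⊆ O) :
    segment ℝ x y ⊆ O := by
  rw [← insert_endpoints_openSegment]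
  exact insert_subset hx (insert_subset hy h)

theorem segment_subset_of_isPreconnected (ho : IsOpen U)
    (hlsc : ∀ x ∈ frontier U \ {P}, LocallyStrictlyConvexAt U x)
    {c x : EuclideanSpace ℝ (Fin n)} {A : Set (EuclideanSpace ℝ (Fin n))} (hA : IsPreconnected A)
    (hAU : A ⊆ U) (hx : x ∈ A) (hcx : segment ℝ c x ⊆ U)
    (hP : ∀ z ∈ A, segment ℝ c z ⊆ closure U → P ∉ openSegment ℝ c z) :
    ∀ z ∈ A, segment ℝ c z ⊆ U := by
  have hopen : IsOpen {z | segment ℝ c z ⊆ U} :=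
    (isOpen_setOf_segment_subset ho).preimage (Continuous.prodMk_right c)
  have hclosed : IsClosed {z | segment ℝ c z ⊆ closure U} :=
    (isClosed_setOf_segment_subset isClosed_closure).preimage (Continuous.prodMk_right c)
  refine hA.subset_of_closure_inter_subset hopen ⟨x, hx, hcx⟩ ?_
  rintro z ⟨hz, hzA⟩
  have hcl : segment ℝ c z ⊆ closure U :=
    closure_minimal (fun w hw => Subset.trans hw subset_closure) hclosed hz
  have hc : c ∈ U := hcx (left_mem_segment ℝ c x)
  refine segment_subset_of_openSegment_subset hc (hAU hzA) ?_
  rcases eq_or_ne c z with rfl | hne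
  · simpa using hc
  · exact openSegment_subset_of_subset_closure ho hlsc hne (hP z hzA hcl)
      ((openSegment_subset_segment ℝ c z).trans hcl)

theorem exists_openSegment_subset (ho : IsOpen U) (hc : IsConnected U)
    (hlsc : ∀ x ∈ frontier U \ {P}, LocallyStrictlyConvexAt U x) (hP : P ∈ frontier U) :
    ∃ x ∈ U, openSegment ℝ P x ⊆ U := by
  by_contra! H
  rw [ho.frontier_eq] at hP
  obtain ⟨a, ha⟩ := hc.nonempty
  have haP : a ≠ P := by
    rintro rfl
    exact hP.2 ha
  have key : ¬ segment ℝ a P ⊆ closure U := fun h => H a ha <| by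
    rw [openSegment_symm]
    exact openSegment_subset_of_subset_closure ho hlsc haP
      (by simpa [right_mem_openSegment_iff] using haP)
      ((openSegment_subset_segment ℝ a P).trans h)
  have hall := segment_subset_of_isPreconnected ho hlsc hc.isPreconnected Subset.rfl ha
    (by simpa using ha) (fun z _ hz hPz => key
      (((convex_segment a z).segment_subset (left_mem_segment ℝ a z)
        (openSegment_subset_segment ℝ a z hPz)).trans hz))
  exact key (closure_minimal (fun z hz => (hall z hz).trans subset_closure)
    ((isClosed_setOf_segment_subset isClosed_closure).preimage (Continuous.prodMk_right a)) hP.1)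

theorem openSegment_subset_of_mem (ho : IsOpen U) (hc : IsConnected U)
    (hlsc : ∀ x ∈ frontier U \ {P}, LocallyStrictlyConvexAt U x) (hP : P ∈ frontier U)
    {x : EuclideanSpace ℝ (Fin n)} (hx : x ∈ U) : openSegment ℝ P x ⊆ U := by
  obtain ⟨a, ha, haP⟩ := exists_openSegment_subset ho hc hlsc hP
  rw [ho.frontier_eq] at hP
  have hne : ∀ z ∈ U, P ≠ z := by
    rintro z hz rfl
    exact hP.2 hz
  have hclosed : IsClosed {z | segment ℝ P z ⊆ closure U} :=
    (isClosed_setOf_segment_subset isClosed_closure).preimage (Continuous.prodMk_right P)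
  have hsees : ∀ z ∈ U, segment ℝ P z ⊆ closure U → openSegment ℝ P z ⊆ U := fun z hz h =>
    openSegment_subset_of_subset_closure ho hlsc (hne z hz)
      (by simpa [left_mem_openSegment_iff] using hne z hz)
      ((openSegment_subset_segment ℝ P z).trans h)
  have hopen : IsOpen {z | z ∈ U ∧ openSegment ℝ P z ⊆ U} := by
    rw [Metric.isOpen_iff]
    rintro z ⟨hz, hzP⟩
    obtain ⟨r, hr, hball⟩ := Metric.isOpen_iff.1 ho z hz
    refine ⟨r, hr, fun z' hz' => ⟨hball hz', hsees z' (hball hz') ?_⟩⟩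
    have hzz' : segment ℝ z z' ⊆ ball z r :=
      (convex_ball z r).segment_subset (mem_ball_self hr) hz'
    have hseg : ∀ c ∈ openSegment ℝ P z, segment ℝ c z' ⊆ U := by
      intro c hcP
      refine segment_subset_of_isPreconnected ho hlsc (convex_segment z z').isPreconnected
        (hzz'.trans hball) (left_mem_segment ℝ z z')
        (segment_subset_of_openSegment_subset (hzP hcP) hz ?_) (fun w hw _ hPw => hP.2 ?_)
        z' (right_mem_segment ℝ z z')
      · refine Subset.trans ?_ hzP
        obtain ⟨s, t, hs, ht, hst, rfl⟩ := hcP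
        rintro _ ⟨u, v, hu, hv, huv, rfl⟩
        refine ⟨u * s, u * t + v, by positivity, by positivity, ?_, by module⟩
        linear_combination u * hst + huv
      · obtain ⟨s, t, hs, ht, hst, rfl⟩ := hcP
        obtain ⟨u, v, hu, hv, huv, hPw⟩ := hPw
        refine hball ((convex_ball z r).segment_subset (mem_ball_self hr) (hzz' hw)
          ⟨u * t / (u * t + v), v / (u * t + v), by positivity, by positivity, by field_simp, ?_⟩)
        have h1 : (u * t + v) • P = (u * t) • z + v • w := by
          have h2 : (u * t + v) = 1 - u * s := by linear_combination huv + u * hst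
          rw [h2, sub_smul, one_smul]
          nth_rewrite 1 [← hPw]
          module
        have h3 : u * t + v ≠ 0 := by positivity
        rw [div_eq_inv_mul, div_eq_inv_mul, mul_smul, mul_smul _ v, ← smul_add, ← h1, smul_smul,
          inv_mul_cancel₀ h3, one_smul]
    have hclosed' : IsClosed {c | segment ℝ c z' ⊆ closure U} :=
      (isClosed_setOf_segment_subset isClosed_closure).preimage (Continuous.prodMk_left z')
    exact closure_minimal (fun c hc => (hseg c hc).trans subset_closure) hclosed'
      (segment_subset_closure_openSegment (left_mem_segment ℝ P z))
  refine (hc.isPreconnected.subset_of_closure_inter_subset hopen ⟨a, ha, ha, haP⟩ ?_ hx).2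
  rintro z ⟨hz, hzU⟩
  refine ⟨hzU, hsees z hzU (closure_minimal (fun w hw => ?_) hclosed hz)⟩
  exact (segment_subset_closure_openSegment).trans (closure_mono hw.2)

theorem openSegment_subset_of_mem_closure (ho : IsOpen U) (hc : IsConnected U)
    (hlsc : ∀ x ∈ frontier U \ {P}, LocallyStrictlyConvexAt U x) (hP : P ∈ frontier U)
    {x : EuclideanSpace ℝ (Fin n)} (hx : x ∈ closure U) (hxP : x ≠ P) :
    openSegment ℝ P x ⊆ U := by
  refine openSegment_subset_of_subset_closure ho hlsc hxP.symm
    (by simpa [left_mem_openSegment_iff] using hxP.symm)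
    ((openSegment_subset_segment ℝ P x).trans (closure_minimal (fun z hz => ?_)
    ((isClosed_setOf_segment_subset isClosed_closure).preimage (Continuous.prodMk_right P)) hx))
  exact segment_subset_closure_openSegment.trans
    (closure_mono (openSegment_subset_of_mem ho hc hlsc hP hz))

end LocallyStrictlyConvex

section StarShaped

variable {n : ℕ} {U : Set (EuclideanSpace ℝ (Fin n))} {P : EuclideanSpace ℝ (Fin n)}

theorem exists_frontier_mem_openSegment (ho : IsOpen U) (hb : Bornology.IsBounded U) (hP : P ∉ U)
    {x : EuclideanSpace ℝ (Fin n)} (hx : x ∈ U) :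
    ∃ y ∈ frontier U \ {P}, x ∈ openSegment ℝ P y := by
  have hxP : x ≠ P := by
    rintro rfl
    exact hP hx
  set L : ℝ → EuclideanSpace ℝ (Fin n) := fun t => AffineMap.lineMap P x t with hL
  have hLc : Continuous L := AffineMap.lineMap_continuous
  have hne : (Ici (1 : ℝ) ∩ L ⁻¹' Uᶜ).Nonempty := by
    obtain ⟨R, hR⟩ := hb.subset_closedBall P
    have hd : 0 < dist P x := dist_pos.2 hxP.symm
    refine ⟨max 1 ((R + 1) / dist P x), mem_Ici.2 (le_max_left _ _), fun hU => ?_⟩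
    have h1 := hR hU
    rw [mem_closedBall, dist_lineMap_left, Real.norm_of_nonneg (by positivity)] at h1
    have h2 := mul_le_mul_of_nonneg_right (le_max_right 1 ((R + 1) / dist P x)) hd.le
    rw [div_mul_cancel₀ _ hd.ne'] at h2
    linarith
  have hcl : IsClosed (Ici (1 : ℝ) ∩ L ⁻¹' Uᶜ) := isClosed_Ici.inter (ho.isClosed_compl.preimage hLc)
  have hbdd : BddBelow (Ici (1 : ℝ) ∩ L ⁻¹' Uᶜ) := ⟨1, fun t ht => ht.1⟩
  have hmem := hcl.csInf_mem hne hbdd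
  set s := sInf (Ici (1 : ℝ) ∩ L ⁻¹' Uᶜ) with hs
  have h1s : 1 < s := lt_of_le_of_ne hmem.1 fun h => hmem.2 (by simpa [hL, ← h] using hx)
  have hlt : ∀ t ∈ Ico 1 s, L t ∈ U := fun t ht => by
    by_contra h
    exact (csInf_le hbdd ⟨ht.1, h⟩).not_gt ht.2
  have hclos : L s ∈ closure U := by
    have : s ∈ closure (Ico 1 s) := by
      rw [closure_Ico h1s.ne]
      exact right_mem_Icc.2 h1s.le
    exact closure_mono (image_subset_iff.2 hlt) (image_closure_subset_closure_image hLc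
      (mem_image_of_mem L this))
  refine ⟨L s, ⟨ho.frontier_eq ▸ ⟨hclos, hmem.2⟩, fun h => ?_⟩, ?_⟩
  · have : s = 0 := by simpa [hL, hxP.symm] using h
    linarith
  · refine ⟨1 - s⁻¹, s⁻¹, sub_pos.2 (inv_lt_one_of_one_lt₀ h1s), by positivity, by ring, ?_⟩
    have hs0 : s ≠ 0 := by positivity
    rw [hL]
    simp only [AffineMap.lineMap_apply_module, smul_add, smul_smul]
    rw [inv_mul_cancel₀ hs0, mul_sub, inv_mul_cancel₀ hs0]
    module

theorem eq_of_mem_openSegment {F : Set (EuclideanSpace ℝ (Fin n))}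
    (hstar : ∀ y ∈ F, ∀ z ∈ openSegment ℝ P y, z ∉ F)
    {x y y' : EuclideanSpace ℝ (Fin n)} (hy : y ∈ F) (hy' : y' ∈ F)
    (hxy : x ∈ openSegment ℝ P y) (hxy' : x ∈ openSegment ℝ P y') : y = y' := by
  have key : ∀ {a b : ℝ} {y y' : EuclideanSpace ℝ (Fin n)}, 0 < a → a < b → y ∈ F → y' ∈ F →
      a • (y - P) = b • (y' - P) → False := by
    intro a b y y' ha hab hy hy' h
    have hb := ha.trans hab
    refine hstar y hy y' ⟨1 - a / b, a / b, by rw [sub_pos, div_lt_one hb]; exact hab,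
      by positivity, by ring, ?_⟩ hy'
    have : y' - P = (a / b) • (y - P) := by
      rw [div_eq_inv_mul, mul_smul, h, smul_smul, inv_mul_cancel₀ hb.ne', one_smul]
    rw [← sub_eq_zero, ← sub_eq_zero.2 this.symm]
    module
  obtain ⟨s, t, hs, ht, hst, rfl⟩ := hxy
  obtain ⟨s', t', hs', ht', hst', h⟩ := hxy'
  have heq : t • (y - P) = t' • (y' - P) := by
    have e1 : s = 1 - t := by linarith
    have e2 : s' = 1 - t' := by linarith
    rw [e1, e2] at h
    rw [← sub_eq_zero, ← sub_eq_zero.2 h.symm]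
    module
  rcases lt_trichotomy t t' with hlt | rfl | hlt
  · exact (key ht hlt hy hy' heq).elim
  · exact sub_left_injective (smul_right_injective _ ht.ne' heq)
  · exact (key ht' hlt hy' hy heq.symm).elim

theorem isPreconnected_frontier_diff_singleton (ho : IsOpen U) (hc : IsConnected U)
    (hb : Bornology.IsBounded U) (hP : P ∉ U)
    (hstar : ∀ y ∈ frontier U \ {P}, openSegment ℝ P y ⊆ U) :
    IsPreconnected (frontier U \ {P}) := by
  have hcompact : IsCompact (frontier U) :=
    Metric.isCompact_of_isClosed_isBounded isClosed_frontier
      (hb.closure.subset frontier_subset_closure)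
  have hfr : ∀ z ∈ frontier U, z ∉ U := fun z hz => by
    rw [ho.frontier_eq] at hz
    exact hz.2
  have huniq : ∀ {x y y'}, y ∈ frontier U \ {P} → y' ∈ frontier U \ {P} →
      x ∈ openSegment ℝ P y → x ∈ openSegment ℝ P y' → y = y' :=
    eq_of_mem_openSegment fun y hy z hz hzf => hfr z hzf.1 (hstar y hy hz)
  set K : Set (EuclideanSpace ℝ (Fin n)) → Set (EuclideanSpace ℝ (Fin n)) := fun u =>
    (fun w : EuclideanSpace ℝ (Fin n) × ℝ => AffineMap.lineMap P w.1 w.2) ''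
      ((frontier U ∩ uᶜ) ×ˢ Icc 0 1) with hK
  have hKclosed : ∀ u, IsOpen u → IsClosed (K u) := fun u hu =>
    (((hcompact.inter_right hu.isClosed_compl).prod isCompact_Icc).image
      (by simp only [AffineMap.lineMap_apply_module]; fun_prop)).isClosed
  have hKmem : ∀ u, ∀ x ∈ U, ∀ y ∈ frontier U \ {P}, x ∈ openSegment ℝ P y →
      (x ∈ K u ↔ y ∉ u) := by
    intro u x hx y hy hxy
    constructor
    · rintro ⟨⟨y', t⟩, ⟨⟨hy', hyu⟩, ht⟩, rfl⟩
      dsimp only at hx hxy hy' hyu ht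
      have hyP : y' ≠ P := by
        rintro rfl
        rw [AffineMap.lineMap_same_apply] at hx
        exact hP hx
      have ht0 : t ≠ 0 := by
        rintro rfl
        rw [AffineMap.lineMap_apply_zero] at hx
        exact hP hx
      have ht1 : t ≠ 1 := by
        rintro rfl
        rw [AffineMap.lineMap_apply_one] at hx
        exact hfr _ hy' hx
      rw [huniq hy ⟨hy', hyP⟩ hxy]
      · exact hyu
      · rw [openSegment_eq_image_lineMap]
        exact mem_image_of_mem _ ⟨lt_of_le_of_ne ht.1 ht0.symm, lt_of_le_of_ne ht.2 ht1⟩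
    · intro hyu
      rw [openSegment_eq_image_lineMap] at hxy
      obtain ⟨t, ht, rfl⟩ := hxy
      exact ⟨(y, t), ⟨⟨hy.1, hyu⟩, ⟨ht.1.le, ht.2.le⟩⟩, rfl⟩
  have hmid : ∀ u, (frontier U \ {P} ∩ u).Nonempty → (U ∩ (K u)ᶜ).Nonempty := by
    rintro u ⟨y, hy, hyu⟩
    have hm : midpoint ℝ P y ∈ openSegment ℝ P y := by
      rw [openSegment_eq_image_lineMap]
      exact ⟨⅟2, by norm_num, rfl⟩
    exact ⟨midpoint ℝ P y, hstar y hy hm, fun h => (hKmem u _ (hstar y hy hm) y hy hm).1 h hyu⟩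
  intro u v hu hv huv hnu hnv
  obtain ⟨x, hx, hxu, hxv⟩ := hc.isPreconnected _ _ (hKclosed u hu).isOpen_compl
    (hKclosed v hv).isOpen_compl (fun x hx => by
      obtain ⟨y, hy, hxy⟩ := exists_frontier_mem_openSegment ho hb hP hx
      rw [mem_union, mem_compl_iff, mem_compl_iff, hKmem u x hx y hy hxy, hKmem v x hx y hy hxy,
        not_not, not_not]
      exact huv hy) (hmid u hnu) (hmid v hnv)
  obtain ⟨y, hy, hxy⟩ := exists_frontier_mem_openSegment ho hb hP hx
  rw [mem_compl_iff, hKmem u x hx y hy hxy, not_not] at hxu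
  rw [mem_compl_iff, hKmem v x hx y hy hxy, not_not] at hxv
  exact ⟨y, hy, hxu, hxv⟩

end StarShaped

theorem HasLipschitzBoundary.accPt {n : ℕ} (hn : 1 < n) {U : Set (EuclideanSpace ℝ (Fin n))}
    (h : HasLipschitzBoundary U) {x : EuclideanSpace ℝ (Fin n)} (hx : x ∈ frontier U) :
    AccPt x (𝓟 (frontier U)) := by
  obtain ⟨W, W', φ, ψ, K, K', ℓ, -, hxW, hW', -, -, hψ, hφm, -, hψφ, hφψ, himg⟩ := h x hx
  have hx' : φ x ∈ W' ∩ {y | ℓ y = 0} := himg ▸ mem_image_of_mem φ ⟨hxW, hx⟩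
  obtain ⟨v, hv, hv0⟩ := (Submodule.ne_bot_iff _).1 (LinearMap.ker_ne_bot_of_finrank_lt
    (f := (ℓ : EuclideanSpace ℝ (Fin n) →ₗ[ℝ] ℝ)) (by simpa using hn))
  have hcont : Tendsto (fun t : ℝ => φ x + t • v) (𝓝[≠] 0) (𝓝 (φ x)) := by
    have : Continuous fun t : ℝ => φ x + t • v := by fun_prop
    simpa using (this.tendsto 0).mono_left (nhdsWithin_le_nhds (s := {0}ᶜ))
  have hmem : ∀ᶠ t in 𝓝[≠] (0 : ℝ), φ x + t • v ∈ W' :=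
    hcont (hW'.mem_nhds hx'.1)
  have hψlim : Tendsto (fun t : ℝ => ψ (φ x + t • v)) (𝓝[≠] 0) (𝓝 x) := by
    have := (hψ.continuousOn.continuousAt (hW'.mem_nhds hx'.1)).tendsto.comp hcont
    rwa [hψφ x hxW] at this
  rw [accPt_iff_frequently]
  refine hψlim.frequently (Eventually.frequently ?_)
  filter_upwards [hmem, self_mem_nhdsWithin] with t ht ht0
  have hker : φ x + t • v ∈ W' ∩ {y | ℓ y = 0} := by
    refine ⟨ht, ?_⟩
    have h1 : ℓ (φ x) = 0 := hx'.2
    have h2 : ℓ v = 0 := hv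
    simp [h1, h2]
  refine ⟨fun heq => ?_, ?_⟩
  · have := hφψ _ ht
    rw [heq] at this
    have h3 : t • v = 0 := by simpa using this.symm
    exact (smul_ne_zero ht0 hv0) h3
  · rw [← himg] at hker
    obtain ⟨w, hw, hwe⟩ := hker
    rw [← hwe, hψφ w hw.1]
    exact hw.2

section Rigidity

variable {E : Type*} [NormedAddCommGroup E] [InnerProductSpace ℝ E] [FiniteDimensional ℝ E]
  {ι : Type*} [Fintype ι] {p : ι → E}

theorem AffineIndependent.eq_of_dist_eq (hp : AffineIndependent ℝ p)
    (hcard : Fintype.card ι = Module.finrank ℝ E + 1) {x y : E}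
    (h : ∀ i, dist x (p i) = dist y (p i)) : x = y := by
  rw [← AffineSubspace.perpBisector_eq_top, eq_top_iff,
    ← hp.affineSpan_eq_top_iff_card_eq_finrank_add_one.2 hcard, affineSpan_le]
  rintro _ ⟨i, rfl⟩
  rw [SetLike.mem_coe, AffineSubspace.mem_perpBisector_iff_dist_eq, dist_comm, h i, dist_comm]

theorem AffineIndependent.isometryEquiv_ext (hp : AffineIndependent ℝ p)
    (hcard : Fintype.card ι = Module.finrank ℝ E + 1) {J J' : E ≃ᵢ E}
    (h : ∀ i, J (p i) = J' (p i)) : J = J' := by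
  refine IsometryEquiv.ext fun x => J.symm.injective
    (hp.eq_of_dist_eq hcard fun i => ?_)
  rw [J.symm_apply_apply, ← J'.isometry.dist_eq x, ← h i, ← J.symm.isometry.dist_eq (J' x),
    J.symm_apply_apply]

theorem AffineIndependent.exists_isometryEquiv (hp : AffineIndependent ℝ p)
    (hcard : Fintype.card ι = Module.finrank ℝ E + 1) {q : ι → E}
    (hpq : ∀ i j, dist (q i) (q j) = dist (p i) (p j)) : ∃ J : E ≃ᵢ E, ∀ i, J (p i) = q i := by
  classical
  obtain ⟨i₀⟩ : Nonempty ι := Fintype.card_pos_iff.1 (by omega)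
  have hli := (affineIndependent_iff_linearIndependent_vsub ℝ p i₀).1 hp
  have hcard' : Fintype.card {i // i ≠ i₀} = Module.finrank ℝ E := by
    rw [Fintype.card_subtype_compl, Fintype.card_subtype_eq, hcard, Nat.add_sub_cancel]
  have hspan := hli.span_eq_top_of_card_eq_finrank' hcard'
  let B := Module.Basis.mk hli hspan.ge
  have hB : ∀ i, B i = p i - p i₀ := fun i => by simp [B]
  let L : E →ₗ[ℝ] E := B.constr ℝ fun i => q i - q i₀
  have hL : ∀ i : ι, L (p i - p i₀) = q i - q i₀ := fun i => by
    by_cases hi : i = i₀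
    · simp [hi]
    · rw [← hB ⟨i, hi⟩, B.constr_basis]
  have hinner : (innerₗ E).compl₁₂ L L = innerₗ E := by
    refine LinearMap.ext_basis B B fun i j => ?_
    rw [LinearMap.compl₁₂_apply, hB, hB, hL, hL, innerₗ_apply_apply, innerₗ_apply_apply,
      real_inner_eq_norm_mul_self_add_norm_mul_self_sub_norm_sub_mul_self_div_two,
      real_inner_eq_norm_mul_self_add_norm_mul_self_sub_norm_sub_mul_self_div_two,
      sub_sub_sub_cancel_right, sub_sub_sub_cancel_right]
    simp only [← dist_eq_norm, hpq]
  let e : E ≃ₗᵢ[ℝ] E := (L.isometryOfInner fun x y =>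
    LinearMap.congr_fun₂ hinner x y).toLinearIsometryEquiv rfl
  refine ⟨(IsometryEquiv.subRight (p i₀)).trans (e.toIsometryEquiv.trans
    (IsometryEquiv.addRight (q i₀))), fun i => ?_⟩
  have : e (p i - p i₀) = q i - q i₀ := hL i
  simp [this]

theorem AffineIndependent.exists_isometryEquiv_eqOn (hp : AffineIndependent ℝ p)
    (hcard : Fintype.card ι = Module.finrank ℝ E + 1) {S : Set E} (hpS : ∀ i, p i ∈ S) {g : E → E}
    (hg : ∀ x ∈ S, ∀ y ∈ S, dist (g x) (g y) = dist x y) : ∃ J : E ≃ᵢ E, EqOn g J S := by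
  obtain ⟨J, hJ⟩ := hp.exists_isometryEquiv hcard fun i j => hg _ (hpS i) _ (hpS j)
  refine ⟨J, fun x hx => J.symm.injective (hp.eq_of_dist_eq hcard fun i => ?_)⟩
  rw [J.symm_apply_apply, ← J.isometry.dist_eq, J.apply_symm_apply, hJ, hg x hx _ (hpS i)]

end Rigidity

namespace BundledDomain

variable {n : ℕ} {D : BundledDomain n} {P : EuclideanSpace ℝ (Fin n)}

theorem dist_eq_dist_supp_of_convex {y : EuclideanSpace ℝ (Fin n)} {r : ℝ}
    (h : Convex ℝ (D.carrier ∩ ball y r)) {c c' : D.Hull} (hc : supp c ∈ ball y r)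
    (hc' : supp c' ∈ ball y r) : dist c c' = dist (supp c) (supp c') := by
  obtain ⟨x, hx, hxlim⟩ := exists_seq_tendsto c
  obtain ⟨x', hx', hxlim'⟩ := exists_seq_tendsto c'
  have hlim := tendsto_of_tendsto_pt hxlim
  have hlim' := tendsto_of_tendsto_pt hxlim'
  refine tendsto_nhds_unique (hxlim.dist hxlim') ((hlim.dist hlim').congr' ?_)
  filter_upwards [hlim (isOpen_ball.mem_nhds hc), hlim' (isOpen_ball.mem_nhds hc')] with k hk hk'
  exact (dist_pt_eq _ _ ((h.segment_subset ⟨hx k, hk⟩ ⟨hx' k, hk'⟩).trans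
    inter_subset_left)).symm

theorem dist_homothety_le {w x : EuclideanSpace ℝ (Fin n)} (hw : w ∈ D.carrier)
    (hx : x ∈ D.carrier)
    (hstar : ∀ x ∈ D.carrier, openSegment ℝ P x ⊆ D.carrier) {p : D.Hull}
    (hp : ∀ z hz, z ∈ segment ℝ w P → dist (pt z hz) p = dist z P) :
    dist (pt x hx) p ≤ dist x P := by
  have hmem : ∀ z ∈ D.carrier, ∀ t ∈ Ioo (0 : ℝ) 1, AffineMap.lineMap P z t ∈ D.carrier :=
    fun z hz t ht => hstar z hz (by
      rw [openSegment_eq_image_lineMap]; exact mem_image_of_mem _ ht)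
  have key : ∀ t (ht : t ∈ Ioo (0 : ℝ) 1), dist (pt x hx) p ≤
      (1 - t) * dist x P + t * dist (pt x hx) (pt w hw) + t * dist w P := by
    intro t ht
    have hmaps : MapsTo (fun z => AffineMap.lineMap P z t) D.carrier D.carrier :=
      fun z hz => hmem z hz t ht
    have e1 : dist (pt x hx) (pt _ (hmem x hx t ht)) = (1 - t) * dist x P := by
      rw [dist_pt_eq, dist_right_lineMap, Real.norm_of_nonneg (sub_nonneg.2 ht.2.le), dist_comm]
      refine segment_subset_of_openSegment_subset hx (hmem x hx t ht) (Subset.trans ?_ (hstar x hx))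
      rw [openSegment_symm]
      rintro _ ⟨a, b, ha, hb, hab, rfl⟩
      refine ⟨a * (1 - t), a * t + b, mul_pos ha (sub_pos.2 ht.2),
        by have := mul_pos ha ht.1; positivity, by linear_combination hab, ?_⟩
      rw [AffineMap.lineMap_apply_module]
      module
    have e2 : dist (pt _ (hmem x hx t ht)) (pt _ (hmem w hw t ht)) ≤
        t * dist (pt x hx) (pt w hw) := by
      have hLip : LipschitzWith t.toNNReal
          (fun z : EuclideanSpace ℝ (Fin n) => AffineMap.lineMap P z t) :=
        LipschitzWith.of_dist_le_mul fun a b => by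
          simp only [AffineMap.lineMap_apply_module, dist_add_left, dist_smul₀]
          rw [Real.norm_of_nonneg ht.1.le, Real.coe_toNNReal _ ht.1.le]
      have := intrinsicDist_image_le (a := x) (b := w)
        (by simpa using ht.1) hLip hmaps
      rw [dist_pt, dist_pt]
      refine (ENNReal.toReal_mono (ENNReal.mul_ne_top (by simp) ?_) this).trans_eq ?_
      · exact intrinsicDist_ne_top D.isOpen D.isPreconnected hx hw
      · rw [ENNReal.toReal_mul, ENNReal.coe_toReal, Real.coe_toNNReal _ ht.1.le]
    have e3 : dist (pt _ (hmem w hw t ht)) p = t * dist w P := by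
      rw [hp, dist_lineMap_left, Real.norm_of_nonneg ht.1.le, dist_comm]
      rw [segment_symm, segment_eq_image_lineMap]
      exact mem_image_of_mem _ ⟨ht.1.le, ht.2.le⟩
    linarith [dist_triangle4 (pt x hx) (pt _ (hmem x hx t ht)) (pt _ (hmem w hw t ht)) p]
  have hlim : Tendsto (fun t : ℝ => (1 - t) * dist x P + t * dist (pt x hx) (pt w hw) +
      t * dist w P) (𝓝[>] 0) (𝓝 (dist x P)) := by
    have : Continuous fun t : ℝ => (1 - t) * dist x P + t * dist (pt x hx) (pt w hw) +
      t * dist w P := by fun_prop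
    simpa using (this.tendsto 0).mono_left (nhdsWithin_le_nhds (s := Ioi 0))
  exact ge_of_tendsto hlim (by
    filter_upwards [Ioo_mem_nhdsGT zero_lt_one] with t ht using key t ht)

theorem exists_bdry_supp_eq
    (hlsc : ∀ x ∈ frontier D.carrier \ {P}, LocallyStrictlyConvexAt D.carrier x)
    (hP : P ∈ frontier D.carrier) {y : EuclideanSpace ℝ (Fin n)} (hy : y ∈ frontier D.carrier) :
    ∃ p ∈ D.bdry, supp p = y ∧ ∃ r > 0, ∀ c : D.Hull, dist (supp c) y < r →
      dist c p = dist (supp c) y := by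
  have hfr := D.isOpen.frontier_eq
  have hstar := fun {x} => openSegment_subset_of_mem_closure (x := x) D.isOpen D.isDomainSet.2 hlsc hP
  have hPU : P ∉ D.carrier := (hfr ▸ hP).2
  rcases eq_or_ne y P with rfl | hyP
  · obtain ⟨w, hw⟩ := D.isDomainSet.2.nonempty
    have hstar' : ∀ x ∈ D.carrier, openSegment ℝ y x ⊆ D.carrier := fun x hx =>
      hstar (subset_closure hx) (fun h => hPU (h ▸ hx))
    obtain ⟨p, hp, hpy, hdist⟩ := exists_bdry_of_openSegment hw hPU
      (by rw [openSegment_symm]; exact hstar' w hw)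
    refine ⟨p, hp, hpy, 1, one_pos, fun c _ => le_antisymm ?_ (hpy ▸ dist_supp_le c p)⟩
    obtain ⟨x, hx, hxlim⟩ := exists_seq_tendsto c
    exact le_of_tendsto_of_tendsto' (hxlim.dist tendsto_const_nhds)
      ((tendsto_of_tendsto_pt hxlim).dist tendsto_const_nhds)
      fun k => dist_homothety_le hw (hx k) hstar' hdist
  · have hm : midpoint ℝ P y ∈ openSegment ℝ P y := by
      rw [openSegment_eq_image_lineMap]
      exact ⟨⅟2, by norm_num, rfl⟩
    have hyU := hstar (frontier_subset_closure hy) hyP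
    obtain ⟨p, hp, hpy, -⟩ := exists_bdry_of_openSegment (D := D) (hyU hm) (hfr ▸ hy).2 (by
      refine Subset.trans ?_ hyU
      obtain ⟨s, t, hs, ht, hst, hm⟩ := hm
      rw [← hm]
      rintro _ ⟨a, b, ha, hb, hab, rfl⟩
      refine ⟨a * s, a * t + b, by positivity, by positivity, ?_, by module⟩
      linear_combination a * hst + hab)
    obtain ⟨r, hr, hconv, -⟩ := hlsc y ⟨hy, hyP⟩
    refine ⟨p, hp, hpy, r, hr, fun c hc => ?_⟩
    rw [dist_eq_dist_supp_of_convex hconv hc (hpy ▸ mem_ball_self hr), hpy]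

theorem exists_dist_eq_dist_supp
    (hlsc : ∀ x ∈ frontier D.carrier \ {P}, LocallyStrictlyConvexAt D.carrier x)
    (hP : P ∈ frontier D.carrier) {p : D.Hull} (hp : p ∈ D.bdry) :
    ∃ r > 0, ∀ c : D.Hull, dist (supp c) (supp p) < r → dist c p = dist (supp c) (supp p) := by
  obtain ⟨q, -, hq, r, hr, h⟩ := exists_bdry_supp_eq hlsc hP (supp_mem_frontier hp)
  obtain rfl : p = q := dist_eq_zero.1 (by simpa using h p (by simpa using hr))
  exact ⟨r, hr, h⟩

theorem injOn_supp
    (hlsc : ∀ x ∈ frontier D.carrier \ {P}, LocallyStrictlyConvexAt D.carrier x)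
    (hP : P ∈ frontier D.carrier) : InjOn (supp (D := D)) D.bdry := by
  intro p _ q hq hpq
  obtain ⟨r, hr, h⟩ := exists_dist_eq_dist_supp hlsc hP hq
  exact dist_eq_zero.1 (by simpa [hpq] using h p (by simpa [hpq] using hr))

end BundledDomain

namespace BundledDomain

variable {n : ℕ} {D V : BundledDomain n}

theorem edist_pt {x y : EuclideanSpace ℝ (Fin n)} (hx : x ∈ D.carrier) (hy : y ∈ D.carrier) :
    edist (pt x hx) (pt y hy) = intrinsicDist D.carrier x y := by
  rw [edist_dist, dist_pt, ENNReal.ofReal_toReal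
    (intrinsicDist_ne_top D.isOpen D.isPreconnected hx hy)]

theorem exists_tendsto_pt_seq (a : HPoint D.carrier) :
    ∃ p : D.Hull, Tendsto (fun k => pt (a.seq k) (a.mem k)) atTop (𝓝 p) := by
  refine cauchySeq_tendsto_of_complete (EMetric.cauchySeq_iff.2 fun ε hε => ?_)
  obtain ⟨N, hN⟩ := a.cauchy ε hε
  exact ⟨N, fun m hm k hk => by rw [edist_pt]; exact hN m hm k hk⟩

/-- The point of the completion represented by an element of the Hausdorff boundary. -/
def toHull (a : HPoint D.carrier) : D.Hull := (exists_tendsto_pt_seq a).choose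

theorem tendsto_toHull (a : HPoint D.carrier) :
    Tendsto (fun k => pt (a.seq k) (a.mem k)) atTop (𝓝 (toHull a)) :=
  (exists_tendsto_pt_seq a).choose_spec

theorem toHull_mem_bdry (a : HPoint D.carrier) : toHull a ∈ D.bdry := by
  intro x hx h
  refine a.not_inner ⟨x, hx, ?_⟩
  have := tendsto_iff_edist_tendsto_0.1 (tendsto_toHull a)
  rw [← h] at this
  exact this.congr fun k => edist_pt _ _

theorem edist_toHull (a b : HPoint D.carrier) : edist (toHull a) (toHull b) = hDist a b := by
  have := (tendsto_toHull a).edist (tendsto_toHull b)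
  simp only [edist_pt] at this
  exact this.liminf_eq.symm

theorem exists_toHull_eq {p : D.Hull} (hp : p ∈ D.bdry) :
    ∃ a : HPoint D.carrier, toHull a = p := by
  obtain ⟨x, hx, hlim⟩ := exists_seq_tendsto p
  let a : HPoint D.carrier :=
    { seq := x
      mem := hx
      cauchy := fun ε hε => by
        obtain ⟨N, hN⟩ := EMetric.cauchySeq_iff.1 hlim.cauchySeq ε hε
        exact ⟨N, fun m hm k hk => by rw [← edist_pt (hx m) (hx k)]; exact hN m hm k hk⟩
      not_inner := by
        rintro ⟨u, hu, h⟩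
        refine hp u hu (tendsto_nhds_unique (tendsto_iff_edist_tendsto_0.2 ?_) hlim)
        exact h.congr fun k => (edist_pt (hx k) hu).symm }
  exact ⟨a, tendsto_nhds_unique (tendsto_toHull a) hlim⟩

/-- `F` restricts to a bijection between the boundaries in the completions which is a local
isometry. -/
structure IsBdryLocalIsometry (F : D.Hull → V.Hull) : Prop where
  mapsTo : MapsTo F D.bdry V.bdry
  injOn : InjOn F D.bdry
  surjOn : SurjOn F D.bdry V.bdry
  dist_eq : ∀ w ∈ D.bdry, ∃ ε > 0, ∀ a ∈ D.bdry, ∀ b ∈ D.bdry, dist a w < ε → dist b w < ε →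
    dist (F a) (F b) = dist a b

theorem exists_isBdryLocalIsometry {f : HPoint D.carrier → HPoint V.carrier}
    (hf : HBoundaryLocalIsometry f) : ∃ F : D.Hull → V.Hull, IsBdryLocalIsometry F := by
  obtain ⟨hinj, hsurj, hloc⟩ := hf
  obtain ⟨v, hv⟩ := V.isDomainSet.2.nonempty
  have hfac : Function.FactorsThrough (fun a => toHull (f a)) (toHull (D := D)) := fun a b hab => by
    rw [← edist_eq_zero, edist_toHull, ← hinj, ← edist_toHull, edist_eq_zero]
    exact hab
  let F : D.Hull → V.Hull := Function.extend toHull (fun a => toHull (f a)) fun _ => pt v hv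
  have hF : ∀ a, F (toHull a) = toHull (f a) := fun a => hfac.extend_apply _ a
  refine ⟨F, fun p hp => ?_, fun p hp q hq h => ?_, fun p hp => ?_, fun w hw => ?_⟩
  · obtain ⟨a, rfl⟩ := exists_toHull_eq hp
    exact hF a ▸ toHull_mem_bdry _
  · obtain ⟨a, rfl⟩ := exists_toHull_eq hp
    obtain ⟨b, rfl⟩ := exists_toHull_eq hq
    rwa [← edist_eq_zero, hF, hF, edist_toHull, ← hinj, ← edist_toHull, edist_eq_zero] at h
  · obtain ⟨b, rfl⟩ := exists_toHull_eq hp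
    obtain ⟨a, ha⟩ := hsurj b
    exact ⟨toHull a, toHull_mem_bdry a, by rw [hF, ← edist_eq_zero, edist_toHull, ha]⟩
  · obtain ⟨w, rfl⟩ := exists_toHull_eq hw
    obtain ⟨ε, hε, h⟩ := hloc w
    have hε' : min ε 1 ≠ ⊤ := ((min_le_right ε 1).trans_lt one_lt_top).ne
    have key : ∀ a : HPoint D.carrier, dist (toHull a) (toHull w) < (min ε 1).toReal →
        hDist a w < ε := fun a ha => by
      rw [dist_edist, ENNReal.toReal_lt_toReal (edist_ne_top _ _) hε', edist_toHull] at ha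
      exact ha.trans_le (min_le_left _ _)
    refine ⟨(min ε 1).toReal, ENNReal.toReal_pos (lt_min hε one_pos).ne' hε', ?_⟩
    rintro a ha b hb haw hbw
    obtain ⟨a, rfl⟩ := exists_toHull_eq ha
    obtain ⟨b, rfl⟩ := exists_toHull_eq hb
    rw [hF, hF, dist_edist, dist_edist, edist_toHull, edist_toHull, h a b (key a haw) (key b hbw)]

end BundledDomain

namespace BundledDomain

variable {n : ℕ} {D V : BundledDomain n} {P : EuclideanSpace ℝ (Fin n)} {F : D.Hull → V.Hull}

theorem exists_section
    (hlsc : ∀ x ∈ frontier D.carrier \ {P}, LocallyStrictlyConvexAt D.carrier x)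
    (hP : P ∈ frontier D.carrier) : ∃ s : EuclideanSpace ℝ (Fin n) → D.Hull,
      (∀ y ∈ frontier D.carrier, s y ∈ D.bdry ∧ supp (s y) = y) ∧ (∀ p ∈ D.bdry, s (supp p) = p) ∧
      ContinuousOn s (frontier D.carrier) := by
  have hne : Nonempty D.Hull := by
    obtain ⟨x, hx⟩ := D.isDomainSet.2.nonempty
    exact ⟨pt x hx⟩
  choose! s hs hsupp r hr hdist using fun y hy => exists_bdry_supp_eq hlsc hP (y := y) hy
  refine ⟨s, fun y hy => ⟨hs y hy, hsupp y hy⟩, fun p hp => ?_, fun y hy => ?_⟩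
  · have hp' := supp_mem_frontier hp
    exact injOn_supp hlsc hP (hs _ hp') hp (hsupp _ hp')
  · refine Metric.continuousWithinAt_iff.2 fun ε hε => ⟨min ε (r y), lt_min hε (hr y hy), ?_⟩
    intro z hz hzy
    have h := hdist y hy (s z)
    rw [hsupp z hz] at h
    rw [h (hzy.trans_le (min_le_right _ _))]
    exact hzy.trans_le (min_le_left _ _)

theorem isCompact_bdry (hb : Bornology.IsBounded D.carrier)
    (hlsc : ∀ x ∈ frontier D.carrier \ {P}, LocallyStrictlyConvexAt D.carrier x)
    (hP : P ∈ frontier D.carrier) : IsCompact D.bdry := by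
  obtain ⟨s, hs, hsinv, hcont⟩ := exists_section hlsc hP
  have hcompact : IsCompact (frontier D.carrier) :=
    Metric.isCompact_of_isClosed_isBounded isClosed_frontier
      (hb.closure.subset frontier_subset_closure)
  convert hcompact.image_of_continuousOn hcont
  refine Subset.antisymm (fun p hp => ⟨supp p, supp_mem_frontier hp, hsinv p hp⟩) ?_
  rintro _ ⟨y, hy, rfl⟩
  exact (hs y hy).1

namespace IsBdryLocalIsometry

theorem continuousOn (hF : IsBdryLocalIsometry F) : ContinuousOn F D.bdry := by
  intro w hw
  obtain ⟨δ, hδ, h⟩ := hF.dist_eq w hw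
  refine Metric.continuousWithinAt_iff.2 fun ε hε => ⟨min ε δ, lt_min hε hδ, fun z hz hzw => ?_⟩
  rw [h z hz w hw (hzw.trans_le (min_le_right _ _)) (by simpa using hδ)]
  exact hzw.trans_le (min_le_left _ _)

theorem exists_forall_dist_lt (hF : IsBdryLocalIsometry F) (hK : IsCompact D.bdry) {x : D.Hull}
    (hx : x ∈ D.bdry) {ε : ℝ} (hε : 0 < ε) :
    ∃ κ > 0, ∀ c ∈ D.bdry, dist (F c) (F x) < κ → dist c x < ε := by
  have hK' : IsCompact (D.bdry ∩ {c | ε ≤ dist c x}) :=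
    hK.inter_right (isClosed_le continuous_const (continuous_id.dist continuous_const))
  obtain ⟨κ, hκ, h⟩ := hK'.exists_forall_le' (f := fun c => dist (F c) (F x)) (a := 0)
    (by have := hF.continuousOn.mono inter_subset_left (t := D.bdry ∩ {c | ε ≤ dist c x}); fun_prop) (fun c hc => dist_pos.2
      fun h => by
        have : ε ≤ dist c x := hc.2
        rw [hF.injOn hc.1 hx h, dist_self] at this
        exact hε.not_ge this)
  refine ⟨κ, hκ, fun c hc hlt => ?_⟩
  by_contra! hle
  exact (h c ⟨hc, hle⟩).not_gt hlt

theorem exists_boundaryAvoiding (hF : IsBdryLocalIsometry F) (hK : IsCompact D.bdry) {x : D.Hull}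
    (hx : x ∈ D.bdry) (hlsc : LocallyStrictlyConvexAt D.carrier (supp x)) :
    ∃ ε > 0, ∀ a ∈ D.bdry, ∀ b ∈ D.bdry, dist a x < ε → dist b x < ε → a ≠ b →
      dist (F a) (F b) = dist (supp a) (supp b) ∧ BoundaryAvoiding (F a) (F b) := by
  obtain ⟨r, hr, hconv, hstrict⟩ := hlsc
  obtain ⟨ε₁, hε₁, hiso⟩ := hF.dist_eq x hx
  obtain ⟨ρ, hρ, hρr, hρε⟩ : ∃ ρ > 0, ρ < r ∧ ρ < ε₁ :=
    ⟨min r ε₁ / 2, half_pos (lt_min hr hε₁), (half_lt_self (lt_min hr hε₁)).trans_le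
      (min_le_left _ _), (half_lt_self (lt_min hr hε₁)).trans_le (min_le_right _ _)⟩
  obtain ⟨κ, hκ, hκρ⟩ := hF.exists_forall_dist_lt hK hx hρ
  have hball : ∀ c, dist c x ≤ ρ → supp c ∈ ball (supp x) r := fun c hc =>
    ((dist_supp_le c x).trans hc).trans_lt hρr
  have hflat : ∀ c c', dist c x ≤ ρ → dist c' x ≤ ρ → dist c c' = dist (supp c) (supp c') :=
    fun c c' hc hc' => dist_eq_dist_supp_of_convex hconv (hball c hc) (hball c' hc')
  have hFdist : ∀ c ∈ D.bdry, ∀ c' ∈ D.bdry, dist c x ≤ ρ → dist c' x ≤ ρ →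
      dist (F c) (F c') = dist c c' := fun c hc c' hc' h h' =>
    hiso c hc c' hc' (h.trans_lt hρε) (h'.trans_lt hρε)
  refine ⟨min ρ (κ / 8), lt_min hρ (by positivity), fun a ha b hb hax hbx hab => ?_⟩
  have haρ := (hax.trans_le (min_le_left _ _)).le
  have hbρ := (hbx.trans_le (min_le_left _ _)).le
  have hxx : dist x x ≤ ρ := by simpa using hρ.le
  refine ⟨(hFdist a ha b hb haρ hbρ).trans (hflat a b haρ hbρ), fun δ hδ => ?_⟩
  have hK' : IsCompact
      (D.bdry ∩ ({c | dist c x ≤ ρ} ∩ ({c | δ ≤ dist a c} ∩ {c | δ ≤ dist c b}))) := by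
    refine hK.inter_right ((isClosed_le (by fun_prop) (by fun_prop)).inter
      ((isClosed_le (by fun_prop) (by fun_prop)).inter (isClosed_le (by fun_prop) (by fun_prop))))
  obtain ⟨m, hm, hmin⟩ := hK'.exists_forall_le' (f := fun c => dist a c + dist c b) (a := dist a b)
    (by fun_prop) (by
      rintro c ⟨hc, hcρ, hac, hcb⟩
      refine lt_of_le_of_ne (dist_triangle a c b) fun h => ?_
      rw [hflat a b haρ hbρ, hflat a c haρ hcρ, hflat c b hcρ hbρ, eq_comm,
        dist_add_dist_eq_iff] at h
      replace hac : δ ≤ dist (supp a) (supp c) := hflat a c haρ hcρ ▸ hac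
      replace hcb : δ ≤ dist (supp c) (supp b) := hflat c b hcρ hbρ ▸ hcb
      have hca : supp c ≠ supp a := fun h => by
        rw [h, dist_self] at hac
        exact hδ.not_ge hac
      have hcb' : supp c ≠ supp b := fun h => by
        rw [h, dist_self] at hcb
        exact hδ.not_ge hcb
      refine mem_bdry_iff.1 hc (hstrict _ ⟨supp_mem_frontier ha, hball a haρ⟩ _
        ⟨supp_mem_frontier hb, hball b hbρ⟩ (fun h' => ?_) ?_)
      · rw [h', wbtw_self_iff] at h
        exact hcb' h
      · exact mem_openSegment_of_ne_left_right hca.symm hcb'.symm h.mem_segment)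
  refine ⟨min ((m - dist a b) / 2) (κ / 8), lt_min (half_pos (sub_pos.2 hm)) (by positivity), ?_⟩
  intro v hv hav hvb
  obtain ⟨c, hc, rfl⟩ := hF.surjOn hv
  by_contra! hle
  have h1 : dist (F a) (F x) < κ / 8 := by
    rw [hFdist a ha x hx haρ hxx]
    exact hax.trans_le (min_le_right _ _)
  have h2 : dist (F b) (F x) < κ / 8 := by
    rw [hFdist b hb x hx hbρ hxx]
    exact hbx.trans_le (min_le_right _ _)
  have h3 := dist_triangle (F c) (F a) (F x)
  have h4 := dist_triangle_right (F a) (F b) (F x)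
  have h5 := min_le_right ((m - dist a b) / 2) (κ / 8)
  have h6 := min_le_left ((m - dist a b) / 2) (κ / 8)
  have h7 := dist_nonneg (x := F c) (y := F b)
  rw [dist_comm (F c) (F a)] at h3
  have hcρ : dist c x ≤ ρ := (hκρ c hc (by linarith)).le
  rw [hFdist a ha c hc haρ hcρ] at hav hle
  rw [hFdist c hc b hb hcρ hbρ] at hvb hle
  rw [hFdist a ha b hb haρ hbρ] at hle
  have := hmin c ⟨hc, hcρ, hav, hvb⟩
  linarith

theorem exists_dist_supp_eq (hF : IsBdryLocalIsometry F) (hK : IsCompact D.bdry) {x : D.Hull}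
    (hx : x ∈ D.bdry) (hlsc : LocallyStrictlyConvexAt D.carrier (supp x)) :
    ∃ ε > 0, ∀ a ∈ D.bdry, ∀ b ∈ D.bdry, dist a x < ε → dist b x < ε → a ≠ b →
      dist (supp (F a)) (supp (F b)) = dist (supp a) (supp b) ∧
      openSegment ℝ (supp (F a)) (supp (F b)) ⊆ V.carrier := by
  obtain ⟨ε, hε, h⟩ := hF.exists_boundaryAvoiding hK hx hlsc
  refine ⟨ε, hε, fun a ha b hb hax hbx hab => ?_⟩
  obtain ⟨hd, hav⟩ := h a ha b hb hax hbx hab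
  exact ⟨hav.dist_supp.trans hd,
    hav.openSegment_subset (dist_pos.2 fun heq => hab (hF.injOn ha hb heq))⟩

end IsBdryLocalIsometry

end BundledDomain

theorem exists_affineIndependent_frontier {n : ℕ} {U : Set (EuclideanSpace ℝ (Fin n))}
    {y : EuclideanSpace ℝ (Fin n)} (ho : IsOpen U) (hlsc : LocallyStrictlyConvexAt U y)
    (hy : y ∈ frontier U) (hacc : AccPt y (𝓟 (frontier U))) {ε : ℝ} (hε : 0 < ε) :
    ∃ p : Fin 3 → EuclideanSpace ℝ (Fin n), AffineIndependent ℝ p ∧ (∀ i, p i ∈ frontier U) ∧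
      (∀ i, dist (p i) y < ε) ∧ openSegment ℝ (p 0) (p 1) ⊆ U := by
  obtain ⟨r, hr, -, hstrict⟩ := hlsc
  rw [accPt_iff_nhds] at hacc
  obtain ⟨a, ⟨ha, haf⟩, hay⟩ := hacc (ball y (min r ε)) (ball_mem_nhds _ (lt_min hr hε))
  obtain ⟨b, ⟨hb, hbf⟩, hby⟩ := hacc (ball y (min (min r ε) (dist a y)))
    (ball_mem_nhds _ (lt_min (lt_min hr hε) (dist_pos.2 hay)))
  have hab : a ≠ b := by
    rintro rfl
    exact ((mem_ball.1 hb).trans_le (min_le_right _ _)).false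
  replace hb := ball_subset_ball (min_le_left _ _) hb
  have hr' := ball_subset_ball (x := y) (min_le_left r ε)
  have hε' := ball_subset_ball (x := y) (min_le_right r ε)
  have hseg : ∀ p q z, p ∈ frontier U ∩ ball y r → q ∈ frontier U ∩ ball y r →
      z ∈ frontier U ∩ ball y r → p ≠ q → q ≠ z → p ≠ z → ¬ Wbtw ℝ p q z := by
    intro p q z hp hq hz hpq hqz hpz h
    have := hstrict p hp z hz hpz (mem_openSegment_of_ne_left_right hpq hqz.symm h.mem_segment)
    exact disjoint_right.1 (disjoint_frontier_iff_isOpen.2 ho) this hq.1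
  have ma : a ∈ frontier U ∩ ball y r := ⟨haf, hr' ha⟩
  have mb : b ∈ frontier U ∩ ball y r := ⟨hbf, hr' hb⟩
  have my : y ∈ frontier U ∩ ball y r := ⟨hy, mem_ball_self hr⟩
  refine ⟨![a, b, y], ?_, ?_, ?_, hstrict a ma b mb hab⟩
  · rw [affineIndependent_iff_not_collinear_set]
    intro hcol
    rcases hcol.wbtw_or_wbtw_or_wbtw with h | h | h
    · exact hseg _ _ _ ma mb my hab hby hay h
    · exact hseg _ _ _ mb my ma hby hay.symm hab.symm h
    · exact hseg _ _ _ my ma mb hay.symm hab hby.symm h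
  · simp [Fin.forall_fin_succ, haf, hbf, hy]
  · simpa [Fin.forall_fin_succ, hε] using ⟨hε' ha, hε' hb⟩

theorem exists_isometryEquiv_eqOn_of_locally {E : Type*} [NormedAddCommGroup E]
    [InnerProductSpace ℝ E] [FiniteDimensional ℝ E] {ι : Type*} [Fintype ι]
    (hcard : Fintype.card ι = Module.finrank ℝ E + 1) {S T : Set E} (hS : IsPreconnected S)
    (hSne : S.Nonempty) (hST : S ⊆ T) {g : E → E}
    (hgen : ∀ y ∈ S, ∀ ε > 0, ∃ p : ι → E, AffineIndependent ℝ p ∧ ∀ i, p i ∈ T ∩ ball y ε)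
    (hg : ∀ y ∈ S, ∃ ε > 0, ∀ a ∈ T ∩ ball y ε, ∀ b ∈ T ∩ ball y ε,
      dist (g a) (g b) = dist a b) : ∃ J : E ≃ᵢ E, EqOn g J S := by
  have hloc : ∀ y ∈ S, ∃ J : E ≃ᵢ E, ∃ ε > 0, EqOn g J (T ∩ ball y ε) := by
    intro y hy
    obtain ⟨ε, hε, h⟩ := hg y hy
    obtain ⟨p, hp, hpT⟩ := hgen y hy ε hε
    obtain ⟨J, hJ⟩ := hp.exists_isometryEquiv_eqOn hcard hpT h
    exact ⟨J, ε, hε, hJ⟩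
  choose! J ε hε hJ using hloc
  obtain ⟨y₀, hy₀⟩ := hSne
  have hconst : ∀ y ∈ S, J y₀ = J y := by
    intro y hy
    refine hS.induction₂ (fun y z => J y = J z) (fun y hy => ?_) (fun _ _ _ _ _ _ => Eq.trans)
      (fun _ _ _ _ => Eq.symm) hy₀ hy
    filter_upwards [self_mem_nhdsWithin, mem_nhdsWithin_of_mem_nhds (ball_mem_nhds y (hε y hy))]
      with z hz hzy
    obtain ⟨δ, hδ, hδy⟩ := Metric.isOpen_iff.1 isOpen_ball z hzy
    obtain ⟨p, hp, hpT⟩ := hgen z hz (min δ (ε z)) (lt_min hδ (hε z hz))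
    refine hp.isometryEquiv_ext hcard fun i => ?_
    rw [← hJ y hy ⟨(hpT i).1, hδy (ball_subset_ball (min_le_left _ _) (hpT i).2)⟩,
      ← hJ z hz ⟨(hpT i).1, ball_subset_ball (min_le_right _ _) (hpT i).2⟩]
  exact ⟨J y₀, fun y hy => by
    rw [hconst y hy]
    exact hJ y hy ⟨hST hy, mem_ball_self (hε y hy)⟩⟩

theorem IsPreconnected.subset_of_frontier_subset {X : Type*} [TopologicalSpace X] {A B : Set X}
    (hA : IsPreconnected A) (hAo : IsOpen A) (hB : IsOpen B) (h : frontier B ⊆ frontier A)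
    (hne : (A ∩ B).Nonempty) : A ⊆ B := by
  refine hA.subset_of_closure_inter_subset hB hne ?_
  rintro z ⟨hz, hzA⟩
  by_contra hzB
  exact disjoint_right.1 (disjoint_frontier_iff_isOpen.2 hAo) hzA (h (hB.frontier_eq ▸ ⟨hz, hzB⟩))

namespace BundledDomain

theorem frontier_subset_closure_supp_bdry {n : ℕ} (D : BundledDomain n) :
    frontier D.carrier ⊆ closure (supp '' D.bdry) := by
  intro y hy
  rw [D.isOpen.frontier_eq] at hy
  refine Metric.mem_closure_iff.2 fun ε hε => ?_
  obtain ⟨w, hw, hwy⟩ := Metric.mem_closure_iff.1 hy.1 (ε / 2) (half_pos hε)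
  obtain ⟨p, hp, hpw⟩ := exists_bdry_dist_lt hw
    (fun h : ball w (ε / 2) ⊆ D.carrier => hy.2 (h hwy))
  refine ⟨supp p, mem_image_of_mem _ hp, ?_⟩
  have h1 := dist_supp_le (pt w hw) p
  rw [supp_pt] at h1
  linarith [dist_triangle y w (supp p)]

theorem exists_isometryEquiv_image_eq {D V : BundledDomain 2} {P : EuclideanSpace ℝ (Fin 2)}
    {F : D.Hull → V.Hull} (hF : IsBdryLocalIsometry F)
    (hb : Bornology.IsBounded D.carrier) (hLip : HasLipschitzBoundary D.carrier)
    (hP : P ∈ frontier D.carrier)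
    (hlsc : ∀ x ∈ frontier D.carrier \ {P}, LocallyStrictlyConvexAt D.carrier x) :
    ∃ J : EuclideanSpace ℝ (Fin 2) ≃ᵢ EuclideanSpace ℝ (Fin 2), J '' D.carrier = V.carrier := by
  have hK := isCompact_bdry hb hlsc hP
  obtain ⟨s, hs, hsinv, hscont⟩ := exists_section hlsc hP
  have hcard : Fintype.card (Fin 3) = Module.finrank ℝ (EuclideanSpace ℝ (Fin 2)) + 1 := by simp
  have hcompact : IsCompact (frontier D.carrier) :=
    Metric.isCompact_of_isClosed_isBounded isClosed_frontier
      (hb.closure.subset frontier_subset_closure)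
  have hacc := fun {y} hy => hLip.accPt one_lt_two (x := y) hy
  have hconn : IsPreconnected (frontier D.carrier \ {P}) := by
    refine isPreconnected_frontier_diff_singleton D.isOpen D.isDomainSet.2 hb
      (disjoint_left.1 (disjoint_frontier_iff_isOpen.2 D.isOpen) hP) fun y hy => ?_
    exact openSegment_subset_of_mem_closure D.isOpen D.isDomainSet.2 hlsc hP
      (frontier_subset_closure hy.1) hy.2
  have hPcl : P ∈ closure (frontier D.carrier \ {P}) := by
    rw [mem_closure_iff_clusterPt, ← accPt_principal_iff_clusterPt]
    exact hacc hP
  have hne : (frontier D.carrier \ {P}).Nonempty := closure_nonempty_iff.1 ⟨P, hPcl⟩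
  set g : EuclideanSpace ℝ (Fin 2) → EuclideanSpace ℝ (Fin 2) := fun y => supp (F (s y)) with hg
  have hgcont : ContinuousOn g (frontier D.carrier) :=
    continuous_supp.comp_continuousOn (hF.continuousOn.comp hscont fun y hy => (hs y hy).1)
  have hloc : ∀ y ∈ frontier D.carrier \ {P}, ∃ ε > 0, ∀ a ∈ frontier D.carrier ∩ ball y ε,
      ∀ b ∈ frontier D.carrier ∩ ball y ε, a ≠ b → dist (g a) (g b) = dist a b ∧
        openSegment ℝ (g a) (g b) ⊆ V.carrier := by
    intro y hy
    obtain ⟨ε, hε, h⟩ := hF.exists_dist_supp_eq hK (hs y hy.1).1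
      ((hs y hy.1).2.symm ▸ hlsc y hy)
    obtain ⟨δ, hδ, hδε⟩ := Metric.continuousWithinAt_iff.1 (hscont y hy.1) ε hε
    refine ⟨δ, hδ, fun a ha b hb hab => ?_⟩
    have := h (s a) (hs a ha.1).1 (s b) (hs b hb.1).1 (hδε ha.1 ha.2) (hδε hb.1 hb.2)
      (fun heq => hab (by rw [← (hs a ha.1).2, heq, (hs b hb.1).2]))
    rwa [(hs a ha.1).2, (hs b hb.1).2] at this
  obtain ⟨J, hJ⟩ : ∃ J : EuclideanSpace ℝ (Fin 2) ≃ᵢ EuclideanSpace ℝ (Fin 2),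
      EqOn g J (frontier D.carrier \ {P}) := by
    refine exists_isometryEquiv_eqOn_of_locally hcard hconn hne sdiff_subset (fun y hy ε hε => ?_)
      fun y hy => ?_
    · obtain ⟨p, hp, hpf, hpε, -⟩ :=
        exists_affineIndependent_frontier D.isOpen (hlsc y hy) hy.1 (hacc hy.1) hε
      exact ⟨p, hp, fun i => ⟨hpf i, hpε i⟩⟩
    · obtain ⟨ε, hε, h⟩ := hloc y hy
      refine ⟨ε, hε, fun a ha b hb => ?_⟩
      rcases eq_or_ne a b with rfl | hab
      · simp
      · exact (h a ha b hb hab).1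
  replace hJ : EqOn g J (frontier D.carrier) :=
    hJ.of_subset_closure hgcont J.continuous.continuousOn sdiff_subset fun y hy => by
      rcases eq_or_ne y P with rfl | h
      · exact hPcl
      · exact subset_closure ⟨hy, h⟩
  have hsupp : supp '' V.bdry = J '' frontier D.carrier := by
    rw [← hJ.image_eq]
    refine Subset.antisymm ?_ ?_
    · rintro _ ⟨q, hq, rfl⟩
      obtain ⟨p, hp, rfl⟩ := hF.surjOn hq
      exact ⟨supp p, supp_mem_frontier hp, by rw [hg]; simp only [hsinv p hp]⟩
    · rintro _ ⟨y, hy, rfl⟩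
      exact ⟨F (s y), hF.mapsTo (hs y hy).1, rfl⟩
  have hfront : frontier V.carrier = frontier (J '' D.carrier) := by
    have himg : frontier (J '' D.carrier) = J '' frontier D.carrier :=
      (J.toHomeomorph.image_frontier D.carrier).symm
    rw [himg, ← hsupp]
    refine Subset.antisymm ?_ (image_subset_iff.2 fun q hq => supp_mem_frontier hq)
    have hclosed : IsClosed (supp '' V.bdry) := by
      rw [hsupp]
      exact (hcompact.image J.continuous).isClosed
    exact V.frontier_subset_closure_supp_bdry.trans hclosed.closure_subset
  have hmeet : (J '' D.carrier ∩ V.carrier).Nonempty := by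
    obtain ⟨y, hy⟩ := hne
    obtain ⟨ε, hε, h⟩ := hloc y hy
    obtain ⟨p, hp, hpf, hpε, hpU⟩ :=
      exists_affineIndependent_frontier D.isOpen (hlsc y hy) hy.1 (hacc hy.1) hε
    have hmid : ∀ a b : EuclideanSpace ℝ (Fin 2), midpoint ℝ a b ∈ openSegment ℝ a b :=
      fun a b => by
        rw [openSegment_eq_image_lineMap]
        exact ⟨⅟2, by norm_num, rfl⟩
    refine ⟨J (midpoint ℝ (p 0) (p 1)), mem_image_of_mem _ (hpU (hmid _ _)), ?_⟩
    rw [J.map_midpoint, ← hJ (hpf 0), ← hJ (hpf 1)]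
    exact (h _ ⟨hpf 0, hpε 0⟩ _ ⟨hpf 1, hpε 1⟩ (hp.injective.ne (by decide))).2 (hmid _ _)
  have hopen : IsOpen (J '' D.carrier) := J.toHomeomorph.isOpenMap _ D.isOpen
  exact ⟨J, Subset.antisymm
    ((D.isPreconnected.image J J.continuous.continuousOn).subset_of_frontier_subset hopen V.isOpen
      hfront.subset hmeet)
    (V.isPreconnected.subset_of_frontier_subset V.isOpen hopen hfront.superset
      (by rwa [inter_comm]))⟩

end BundledDomain

/-- a bounded nonconvex plane domain with Lipschitz boundary which
is locally strictly convex (with the convexity directed toward the complement)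
at every boundary point except one point `P` is uniquely determined in the class
of all plane domains by the condition of local isometry of the Hausdorff
boundaries in the relative metrics. -/
theorem nonconvex_locally_strictly_convex_uniquely_determined
    (U : Set (EuclideanSpace ℝ (Fin 2)))
    (hU : IsDomainSet U) (hUbd : Bornology.IsBounded U)
    (hUb : HasLipschitzBoundary U) (hUnconv : ¬ Convex ℝ U)
    (P : EuclideanSpace ℝ (Fin 2)) (hP : P ∈ frontier U)
    (hlsc : ∀ x ∈ frontier U \ {P}, LocallyStrictlyConvexAt U x) :
    ∀ V : Set (EuclideanSpace ℝ (Fin 2)), IsDomainSet V →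
      (∃ f : HPoint U → HPoint V, HBoundaryLocalIsometry f) →
      ∃ J : EuclideanSpace ℝ (Fin 2) ≃ᵢ EuclideanSpace ℝ (Fin 2), J '' U = V := by
  intro V hV ⟨f, hf⟩
  obtain ⟨F, hF⟩ := BundledDomain.exists_isBdryLocalIsometry (D := ⟨U, hU⟩) (V := ⟨V, hV⟩) hf
  exact BundledDomain.exists_isometryEquiv_image_eq hF hUbd hUb hP hlsc

end
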